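/- There exist constants c₁, c₂ > 0 such that for every integer a ≥ 8 for which the ring of integers of the simplest cubic field K_a equals ℤ[ρ], and for every real number x ≥ 1, one has c₁·((log a)²·x/a² + (x/a)^(2/3) + 1) ≤ P_p(a, x) ≤ c₂·((log a)²·x/a² + (x/a)^(2/3) + 1). -/

import Mathlib

open NumberField

/-- The largest real root of `X³ - aX² - (a+3)X - 1` (for `a ≥ 7` this set of real roots
is nonempty and bounded above, so `sSup` picks out the largest root). -/
noncomputable def simplestCubicRoot (a : ℤ) : ℝ :=
  sSup {x : ℝ | x ^ 3 - (a : ℝ) * x ^ 2 - ((a : ℝ) + 3) * x - 1 = 0}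

lemma sum_inv_sq_le (M : ℕ) : ∑ d ∈ Finset.Icc 2 M, (1 : ℝ) / (d : ℝ) ^ 2 ≤ 3 / 4 := by
  rcases Nat.lt_or_ge M 2 with h | h
  · rw [Finset.Icc_eq_empty (by omega)]; norm_num
  have key : ∑ d ∈ Finset.Icc 2 M, (1 : ℝ) / (d : ℝ) ^ 2 ≤ 3 / 4 - 1 / (M : ℝ) := by
    induction M, h using Nat.le_induction with
    | base => norm_num
    | succ n hn ih =>
      rw [Finset.sum_Icc_succ_top (by omega)]
      have hn' : (2 : ℝ) ≤ n := by exact_mod_cast hn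
      have h3 : (1 : ℝ) / ((n + 1 : ℕ) : ℝ) ^ 2 ≤ 1 / (n : ℝ) - 1 / ((n : ℝ) + 1) := by
        push_cast
        rw [div_sub_div _ _ (by positivity) (by positivity),
          div_le_div_iff₀ (by positivity) (by positivity)]
        nlinarith
      push_cast at h3 ⊢
      linarith
  have : 0 ≤ 1 / (M : ℝ) := by positivity
  linarith

lemma sum_inv_cube_le (M : ℕ) : ∑ d ∈ Finset.Icc 2 M, (1 : ℝ) / (d : ℝ) ^ 3 ≤ 1 / 4 := by
  rcases Nat.lt_or_ge M 1 with h | h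
  · rw [Finset.Icc_eq_empty (by omega)]; norm_num
  have key : ∑ d ∈ Finset.Icc 2 M, (1 : ℝ) / (d : ℝ) ^ 3 ≤
      1 / 4 - 1 / (2 * (M : ℝ) * (M + 1)) := by
    induction M, h using Nat.le_induction with
    | base => norm_num
    | succ n hn ih =>
      rw [Finset.sum_Icc_succ_top (by omega)]
      have hn' : (1 : ℝ) ≤ n := by exact_mod_cast hn
      have h3 : (1 : ℝ) / ((n : ℝ) + 1) ^ 3 ≤
          1 / (2 * (n : ℝ) * (n + 1)) - 1 / (2 * ((n : ℝ) + 1) * (n + 1 + 1)) := by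
        rw [div_sub_div _ _ (by positivity) (by positivity),
          div_le_div_iff₀ (by positivity) (by positivity)]
        have : 0 ≤ (n : ℝ) * (n+1)^2 := by positivity
        nlinarith
      push_cast at h3 ⊢
      linarith
  have : 0 < 1 / (2 * (M : ℝ) * (M + 1)) := by positivity
  linarith

/-- At least a quarter of the pairs in a square box are coprime. -/
lemma card_coprime_pairs (M : ℕ) : (M : ℝ) ^ 2 / 4 ≤
    (((Finset.Ioc 0 M ×ˢ Finset.Ioc 0 M).filter fun z : ℕ × ℕ => Nat.gcd z.1 z.2 = 1).card : ℝ) := by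
  classical
  set A := Finset.Ioc 0 M ×ˢ Finset.Ioc 0 M with hA
  have hsub : A ⊆ (A.filter fun z : ℕ × ℕ => Nat.gcd z.1 z.2 = 1) ∪
      (Finset.Icc 2 M).biUnion fun d =>
        ((Finset.Ioc 0 M).filter (d ∣ ·)) ×ˢ ((Finset.Ioc 0 M).filter (d ∣ ·)) := by
    rintro ⟨p, q⟩ hz
    rw [hA, Finset.mem_product] at hz
    simp only [Finset.mem_Ioc] at hz
    by_cases hg : Nat.gcd p q = 1
    · simp [hA, hg]; omega
    · refine Finset.mem_union_right _ (Finset.mem_biUnion.2 ⟨Nat.gcd p q, ?_, ?_⟩)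
      · have h1 := Nat.gcd_pos_of_pos_left q hz.1.1
        have h2 := Nat.gcd_le_left q hz.1.1
        simp; omega
      · simp [hz, Nat.gcd_dvd_left, Nat.gcd_dvd_right]
  have hcard := (Finset.card_le_card hsub).trans
    ((Finset.card_union_le _ _).trans (Nat.add_le_add_left Finset.card_biUnion_le _))
  simp only [Finset.card_product, Nat.Ioc_filter_dvd_card_eq_div, hA, Nat.card_Ioc, Nat.sub_zero]
    at hcard
  have hbad : ((∑ d ∈ Finset.Icc 2 M, M / d * (M / d) : ℕ) : ℝ) ≤ 3 / 4 * (M : ℝ) ^ 2 := by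
    push_cast
    calc _ ≤ ∑ d ∈ Finset.Icc 2 M, (M : ℝ) ^ 2 * (1 / (d : ℝ) ^ 2) := by
          refine Finset.sum_le_sum fun d hd => ?_
          have := Nat.cast_div_le (α := ℝ) (m := M) (n := d)
          calc ((M / d : ℕ) : ℝ) * ((M / d : ℕ) : ℝ) ≤ ((M : ℝ) / d) * (M / d) := by gcongr
            _ = _ := by ring
      _ = (M : ℝ) ^ 2 * ∑ d ∈ Finset.Icc 2 M, (1 / (d : ℝ) ^ 2) := by rw [Finset.mul_sum]
      _ ≤ (M : ℝ) ^ 2 * (3 / 4) := by gcongr; exact sum_inv_sq_le M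
      _ = _ := by ring
  have hcard' := (Nat.cast_le (α := ℝ)).2 hcard
  push_cast at hcard' hbad
  nlinarith

/-- A positive proportion of the triples in a box are coprime and have no small coordinate. -/
lemma card_coprime_triples (P Q R : ℕ) : 3 / 8 * ((P : ℝ) * Q * R) ≤
    (((Finset.Ioc 0 P ×ˢ Finset.Ioc 0 Q ×ˢ Finset.Ioc 0 R).filter fun z : ℕ × ℕ × ℕ =>
      Nat.gcd z.1 (Nat.gcd z.2.1 z.2.2) = 1 ∧ P < 8 * z.1 ∧ Q < 8 * z.2.1 ∧ R < 8 * z.2.2).card :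
        ℝ) := by
  classical
  set A := Finset.Ioc 0 P ×ˢ Finset.Ioc 0 Q ×ˢ Finset.Ioc 0 R with hA
  have hsub : A ⊆ (A.filter fun z : ℕ × ℕ × ℕ =>
      Nat.gcd z.1 (Nat.gcd z.2.1 z.2.2) = 1 ∧ P < 8 * z.1 ∧ Q < 8 * z.2.1 ∧ R < 8 * z.2.2) ∪
      ((Finset.Icc 2 P).biUnion (fun d =>
        ((Finset.Ioc 0 P).filter (d ∣ ·)) ×ˢ ((Finset.Ioc 0 Q).filter (d ∣ ·)) ×ˢ
          ((Finset.Ioc 0 R).filter (d ∣ ·))) ∪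
      (Finset.Ioc 0 (P / 8) ×ˢ Finset.Ioc 0 Q ×ˢ Finset.Ioc 0 R ∪
      (Finset.Ioc 0 P ×ˢ Finset.Ioc 0 (Q / 8) ×ˢ Finset.Ioc 0 R ∪
       Finset.Ioc 0 P ×ˢ Finset.Ioc 0 Q ×ˢ Finset.Ioc 0 (R / 8)))) := by
    rintro ⟨p, q, r⟩ hz
    rw [hA, Finset.mem_product, Finset.mem_product] at hz
    simp only [Finset.mem_Ioc] at hz
    obtain ⟨hp, hq, hr⟩ := hz
    by_cases hg : Nat.gcd p (Nat.gcd q r) = 1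
    · simp [hA, hg]; omega
    · refine Finset.mem_union_right _ (Finset.mem_union_left _
        (Finset.mem_biUnion.2 ⟨Nat.gcd p (Nat.gcd q r), ?_, ?_⟩))
      · have h1 := Nat.gcd_pos_of_pos_left (Nat.gcd q r) hp.1
        have h2 := Nat.gcd_le_left (Nat.gcd q r) hp.1
        simp; omega
      · have h1 : p.gcd (q.gcd r) ∣ q := (Nat.gcd_dvd_right _ _).trans (Nat.gcd_dvd_left _ _)
        have h2 : p.gcd (q.gcd r) ∣ r := (Nat.gcd_dvd_right _ _).trans (Nat.gcd_dvd_right _ _)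
        simp [hp, hq, hr, Nat.gcd_dvd_left, h1, h2]
  have hcard := (Finset.card_le_card hsub).trans
    ((Finset.card_union_le _ _).trans (Nat.add_le_add_left
      ((Finset.card_union_le _ _).trans (Nat.add_le_add Finset.card_biUnion_le
        ((Finset.card_union_le _ _).trans (Nat.add_le_add_left (Finset.card_union_le _ _) _)))) _))
  simp only [Finset.card_product, Nat.Ioc_filter_dvd_card_eq_div, hA, Nat.card_Ioc, Nat.sub_zero]
    at hcard
  have hbad : ((∑ d ∈ Finset.Icc 2 P, P / d * (Q / d * (R / d)) : ℕ) : ℝ) ≤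
      1 / 4 * ((P : ℝ) * Q * R) := by
    push_cast
    calc _ ≤ ∑ d ∈ Finset.Icc 2 P, ((P : ℝ) * Q * R) * (1 / (d : ℝ) ^ 3) := by
          refine Finset.sum_le_sum fun d hd => ?_
          have h1 := Nat.cast_div_le (α := ℝ) (m := P) (n := d)
          have h2 := Nat.cast_div_le (α := ℝ) (m := Q) (n := d)
          have h3 := Nat.cast_div_le (α := ℝ) (m := R) (n := d)
          calc ((P / d : ℕ) : ℝ) * (((Q / d : ℕ) : ℝ) * ((R / d : ℕ) : ℝ))
              ≤ ((P : ℝ) / d) * ((Q / d) * (R / d)) := by gcongr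
            _ = _ := by ring
      _ = ((P : ℝ) * Q * R) * ∑ d ∈ Finset.Icc 2 P, (1 / (d : ℝ) ^ 3) := by rw [Finset.mul_sum]
      _ ≤ ((P : ℝ) * Q * R) * (1 / 4) := by gcongr; exact sum_inv_cube_le P
      _ = _ := by ring
  have h1 := Nat.cast_div_le (α := ℝ) (m := P) (n := 8)
  have h2 := Nat.cast_div_le (α := ℝ) (m := Q) (n := 8)
  have h3 := Nat.cast_div_le (α := ℝ) (m := R) (n := 8)
  have e1 : ((P / 8 : ℕ) : ℝ) * ((Q : ℝ) * R) ≤ P / 8 * (Q * R) := by gcongr; exact_mod_cast h1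
  have e2 : (P : ℝ) * (((Q / 8 : ℕ) : ℝ) * R) ≤ P * (Q / 8 * R) := by gcongr; exact_mod_cast h2
  have e3 : (P : ℝ) * ((Q : ℝ) * ((R / 8 : ℕ) : ℝ)) ≤ P * (Q * (R / 8)) := by
    gcongr; exact_mod_cast h3
  have hcard' := (Nat.cast_le (α := ℝ)).2 hcard
  push_cast at hcard' hbad
  nlinarith

lemma sum_inv_sqrt_le (n : ℕ) : ∑ q ∈ Finset.Ioc 0 n, 1 / √(q : ℝ) ≤ 2 * √(n : ℝ) := by
  induction n with
  | zero => simp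
  | succ n ih =>
    rw [Finset.sum_Ioc_succ_top (by omega)]
    have h0 : 0 < √((n + 1 : ℕ) : ℝ) := Real.sqrt_pos.2 (by positivity)
    have h1 : √((n + 1 : ℕ) : ℝ) ^ 2 = n + 1 := by
      rw [Real.sq_sqrt (by positivity)]; push_cast; ring
    have h2 : √(n : ℝ) ^ 2 = n := Real.sq_sqrt (by positivity)
    have h3 : 1 / √((n + 1 : ℕ) : ℝ) ≤ 2 * √((n + 1 : ℕ) : ℝ) - 2 * √(n : ℝ) := by
      rw [div_le_iff₀ h0]
      nlinarith [sq_nonneg (√((n + 1 : ℕ) : ℝ) - √(n : ℝ))]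
    linarith

lemma sum_inv_max_le (n : ℕ) {t : ℝ} (ht : 0 < t) :
    ∑ q ∈ Finset.Ioc 0 n, 1 / max (q : ℝ) t ≤ 2 * Real.log (1 + n / t) := by
  have key : ∑ q ∈ Finset.Ioc 0 n, 1 / max (q : ℝ) t ≤ 2 * (Real.log (n + t) - Real.log t) := by
    induction n with
    | zero => simp
    | succ n ih =>
      rw [Finset.sum_Ioc_succ_top (by omega)]
      have hn : (0 : ℝ) < n + t := by positivity
      have hn1 : (0 : ℝ) < (n + 1 : ℕ) + t := by positivity
      have h1 := Real.log_le_sub_one_of_pos (div_pos hn hn1)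
      rw [Real.log_div hn.ne' hn1.ne'] at h1
      have h2 : (n + t) / ((n + 1 : ℕ) + t) - 1 = - (1 / ((n + 1 : ℕ) + t)) := by
        field_simp; push_cast; ring
      have h3 : 1 / max ((n + 1 : ℕ) : ℝ) t ≤ 2 * (1 / ((n + 1 : ℕ) + t)) := by
        have : (0 : ℝ) < max ((n + 1 : ℕ) : ℝ) t := lt_max_of_lt_right ht
        rw [mul_one_div, div_le_div_iff₀ this hn1]
        linarith [le_max_left ((n + 1 : ℕ) : ℝ) t, le_max_right ((n + 1 : ℕ) : ℝ) t]
      linarith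
  rwa [← Real.log_div (by positivity) (by positivity), add_div, div_self ht.ne', add_comm] at key

/-- Counting pairs `(p, q)` with `q * max p q ^ 2 ≤ w ^ 3`. -/
lemma card_pairs_le (s : Finset (ℕ × ℕ)) {w : ℝ} (hw : 0 ≤ w)
    (h : ∀ z ∈ s, 1 ≤ z.2 ∧ (z.2 : ℝ) ≤ w ∧ (z.1 : ℝ) ^ 2 * z.2 ≤ w ^ 3) :
    (s.card : ℝ) ≤ 4 * w ^ 2 := by
  have hmap : ∀ z ∈ s, z.2 ∈ Finset.Ioc 0 ⌊w⌋₊ := fun z hz => by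
    have := h z hz
    exact Finset.mem_Ioc.2 ⟨this.1, Nat.le_floor this.2.1⟩
  rw [Finset.card_eq_sum_card_fiberwise hmap]
  push_cast
  have hfib : ∀ q ∈ Finset.Ioc 0 ⌊w⌋₊,
      ((s.filter fun z => z.2 = q).card : ℝ) ≤ 2 * √(w ^ 3) * (1 / √(q : ℝ)) := by
    intro q hq
    rw [Finset.mem_Ioc] at hq
    have hq1 : (1 : ℝ) ≤ q := by exact_mod_cast hq.1
    have hqw : (q : ℝ) ≤ w := (Nat.le_floor_iff hw).1 hq.2
    have hsub : (s.filter fun z => z.2 = q).card ≤ (Finset.range (⌊√(w ^ 3 / q)⌋₊ + 1)).card := by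
      refine Finset.card_le_card_of_injOn Prod.fst ?_ ?_
      · intro z hz
        rw [Finset.mem_coe, Finset.mem_filter] at hz
        obtain ⟨-, -, h3⟩ := h z hz.1
        rw [hz.2] at h3
        rw [Finset.mem_coe, Finset.mem_range, Nat.lt_succ_iff]
        refine Nat.le_floor (Real.le_sqrt_of_sq_le ?_)
        rwa [le_div_iff₀ (by positivity)]
      · intro z hz z' hz' hzz
        rw [Finset.mem_coe, Finset.mem_filter] at hz hz'
        exact Prod.ext hzz (hz.2.trans hz'.2.symm)
    rw [Finset.card_range] at hsub
    have h1 : (1 : ℝ) ≤ √(w ^ 3 / q) := by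
      rw [Real.one_le_sqrt, le_div_iff₀ (by positivity), one_mul]
      exact hqw.trans (le_self_pow₀ (hq1.trans hqw) (by norm_num))
    have h2 := Nat.floor_le (Real.sqrt_nonneg (w ^ 3 / q))
    have h3 : √(w ^ 3 / q) = √(w ^ 3) * (1 / √(q : ℝ)) := by
      rw [Real.sqrt_div (by positivity), mul_one_div]
    have h4 := (Nat.cast_le (α := ℝ)).2 hsub
    push_cast at h4
    linarith
  calc _ ≤ ∑ q ∈ Finset.Ioc 0 ⌊w⌋₊, 2 * √(w ^ 3) * (1 / √(q : ℝ)) := Finset.sum_le_sum hfib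
    _ = 2 * √(w ^ 3) * ∑ q ∈ Finset.Ioc 0 ⌊w⌋₊, (1 / √(q : ℝ)) := by rw [Finset.mul_sum]
    _ ≤ 2 * √(w ^ 3) * (2 * √(⌊w⌋₊ : ℝ)) := by gcongr; exact sum_inv_sqrt_le _
    _ ≤ 2 * √(w ^ 3) * (2 * √w) := by gcongr; exact Nat.floor_le hw
    _ = 4 * √(w ^ 3 * w) := by rw [Real.sqrt_mul (by positivity)]; ring
    _ = 4 * w ^ 2 := by
      rw [show w ^ 3 * w = (w ^ 2) ^ 2 by ring, Real.sqrt_sq (by positivity)]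

lemma two_le_log_eight : (2 : ℝ) ≤ Real.log 8 := by
  rw [show (8 : ℝ) = 2 ^ 3 by norm_num, Real.log_pow]
  have := Real.log_two_gt_d9
  push_cast
  linarith

/-- A dyadic sum whose terms are capped contributes two logarithms. -/
lemma sum_min_le (S : Finset ℕ) (f : ℕ → ℝ) {a G : ℝ} (ha : 8 ≤ a) (hG : 0 < G)
    (hS : ∀ k ∈ S, (8 : ℝ) ^ k ≤ a ^ 2 * G) (h1 : ∀ k ∈ S, f k ≤ 8 * 8 ^ k)
    (h2 : ∀ k ∈ S, f k ≤ 8 * G * Real.log a) :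
    ∑ k ∈ S, f k ≤ 26 * G * Real.log a ^ 2 := by
  have hL : 2 ≤ Real.log a := two_le_log_eight.trans (Real.log_le_log (by norm_num) ha)
  rw [← Finset.sum_filter_add_sum_filter_not S (fun k => (8 : ℝ) ^ k ≤ G)]
  have hA : ∑ k ∈ S.filter (fun k => (8 : ℝ) ^ k ≤ G), f k ≤ 10 * G := by
    rcases (S.filter (fun k => (8 : ℝ) ^ k ≤ G)).eq_empty_or_nonempty with he | hne
    · rw [he]; simp; positivity
    · set n := (S.filter (fun k => (8 : ℝ) ^ k ≤ G)).max' hne with hn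
      have hnG : (8 : ℝ) ^ n ≤ G := (Finset.mem_filter.1 (Finset.max'_mem _ hne)).2
      calc _ ≤ ∑ k ∈ S.filter (fun k => (8 : ℝ) ^ k ≤ G), 8 * (8 : ℝ) ^ k :=
            Finset.sum_le_sum fun k hk => h1 k (Finset.mem_filter.1 hk).1
        _ ≤ ∑ k ∈ Finset.range (n + 1), 8 * (8 : ℝ) ^ k := by
            refine Finset.sum_le_sum_of_subset_of_nonneg (fun k hk => ?_)
              (fun _ _ _ => by positivity)
            exact Finset.mem_range_succ_iff.2 (Finset.le_max' _ k hk)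
        _ = 8 * ((8 ^ (n + 1) - 1) / (8 - 1)) := by
            rw [← Finset.mul_sum, geom_sum_eq (by norm_num)]
        _ ≤ 10 * G := by rw [pow_succ]; linarith
  have hB : ∑ k ∈ S.filter (fun k => ¬ (8 : ℝ) ^ k ≤ G), f k ≤ 16 * G * Real.log a ^ 2 := by
    set T := S.filter (fun k => ¬ (8 : ℝ) ^ k ≤ G) with hT
    have hcard : (T.card : ℝ) ≤ 2 * Real.log a := by
      rcases T.eq_empty_or_nonempty with he | hne
      · rw [he]; simp; linarith
      · have hmax := Finset.mem_filter.1 (T.max'_mem hne)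
        have hmin := Finset.mem_filter.1 (T.min'_mem hne)
        have hle : T.min' hne ≤ T.max' hne := Finset.min'_le_max' _ _
        obtain ⟨d, hd⟩ := Nat.exists_eq_add_of_le hle
        have hsub : T ⊆ Finset.Icc (T.min' hne) (T.max' hne) := fun k hk =>
          Finset.mem_Icc.2 ⟨Finset.min'_le _ k hk, Finset.le_max' _ k hk⟩
        have hc := Finset.card_le_card hsub
        rw [Nat.card_Icc, hd] at hc
        have hc' : T.card ≤ d + 1 := by omega
        have hpow : (8 : ℝ) ^ d ≤ a ^ 2 := by
          have h3 := hS _ hmax.1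
          have h4 := not_le.1 hmin.2
          rw [hd, pow_add] at h3
          have h5 : (0 : ℝ) < 8 ^ d := by positivity
          by_contra hcon
          push Not at hcon
          have : G * a ^ 2 < 8 ^ T.min' hne * 8 ^ d := by gcongr
          linarith
        have hlog := Real.log_le_log (by positivity) hpow
        rw [Real.log_pow, Real.log_pow] at hlog
        push_cast at hlog
        have h8 := two_le_log_eight
        have hd0 : (0 : ℝ) ≤ d := by positivity
        have : (T.card : ℝ) ≤ d + 1 := by exact_mod_cast hc'
        nlinarith
    calc _ ≤ ∑ k ∈ T, 8 * G * Real.log a :=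
          Finset.sum_le_sum fun k hk => h2 k (Finset.mem_filter.1 hk).1
      _ = T.card * (8 * G * Real.log a) := by rw [Finset.sum_const, nsmul_eq_mul]
      _ ≤ (2 * Real.log a) * (8 * G * Real.log a) := by gcongr
      _ = _ := by ring
  nlinarith [mul_nonneg hG.le (sub_nonneg.2 hL)]

/-- Counting triples `(p, q, r)` with `q`, `r` nonzero. -/
lemma card_triples_le (s : Finset (ℕ × ℕ × ℕ)) {a G : ℝ} (ha : 8 ≤ a) (hG : 0 < G)
    (h : ∀ z ∈ s, 1 ≤ z.2.1 ∧ 1 ≤ z.2.2 ∧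
      ((max z.1 (max z.2.1 z.2.2) : ℕ) : ℝ) * max (a * z.2.1) (max z.1 (max z.2.1 z.2.2) : ℕ) *
        max (a * z.2.2) (max z.1 (max z.2.1 z.2.2) : ℕ) ≤ a ^ 2 * G) :
    (s.card : ℝ) ≤ 26 * G * Real.log a ^ 2 := by
  classical
  set F : ℕ × ℕ × ℕ → ℕ := fun z => Nat.log 2 (max z.1 (max z.2.1 z.2.2)) with hF
  have hpow : ∀ z ∈ s, 2 ^ F z ≤ max z.1 (max z.2.1 z.2.2) ∧
      max z.1 (max z.2.1 z.2.2) < 2 * 2 ^ F z := by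
    intro z hz
    have := h z hz
    refine ⟨Nat.pow_log_le_self 2 (by have := this.1; omega), ?_⟩
    have := Nat.lt_pow_succ_log_self (b := 2) (by norm_num) (max z.1 (max z.2.1 z.2.2))
    rw [pow_succ] at this
    linarith
  have hprod : ∀ z ∈ s, (2 : ℝ) ^ F z * max (a * z.2.1) (2 ^ F z) * max (a * z.2.2) (2 ^ F z) ≤
      a ^ 2 * G := by
    intro z hz
    have h1 : (2 : ℝ) ^ F z ≤ ((max z.1 (max z.2.1 z.2.2) : ℕ) : ℝ) := by
      exact_mod_cast (hpow z hz).1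
    refine le_trans ?_ (h z hz).2.2
    gcongr
  rw [Finset.card_eq_sum_card_image F s]
  push_cast
  refine sum_min_le (s.image F) _ ha hG ?_ ?_ ?_
  · intro k hk
    obtain ⟨z, hz, rfl⟩ := Finset.mem_image.1 hk
    refine le_trans ?_ (hprod z hz)
    rw [show (8 : ℝ) ^ F z = 2 ^ F z * 2 ^ F z * 2 ^ F z by
      rw [← mul_pow, ← mul_pow]; norm_num]
    gcongr <;> exact le_max_right _ _
  · intro k _
    have hsub : s.filter (fun z => F z = k) ⊆
        Finset.range (2 * 2 ^ k) ×ˢ Finset.range (2 * 2 ^ k) ×ˢ Finset.range (2 * 2 ^ k) := by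
      intro z hz
      rw [Finset.mem_filter] at hz
      have := (hpow z hz.1).2
      rw [hz.2] at this
      simp only [Finset.mem_product, Finset.mem_range]
      omega
    have := (Nat.cast_le (α := ℝ)).2 (Finset.card_le_card hsub)
    simp only [Finset.card_product, Finset.card_range] at this
    push_cast at this
    refine this.trans (le_of_eq ?_)
    rw [show (8 : ℝ) ^ k = 2 ^ k * 2 ^ k * 2 ^ k by rw [← mul_pow, ← mul_pow]; norm_num]
    ring
  · intro k _
    set A : ℝ := 2 ^ k with hA
    have hA0 : 0 < A := by positivity
    have ha0 : 0 < a := by linarith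
    have hsub : s.filter (fun z => F z = k) ⊆ Finset.range (2 * 2 ^ k) ×ˢ
        ((Finset.Ioc 0 (2 * 2 ^ k)).biUnion fun q =>
          ({q} : Finset ℕ) ×ˢ Finset.Ioc 0 ⌊G / A * (1 / max (q : ℝ) (A / a))⌋₊) := by
      rintro ⟨p, q, r⟩ hz
      rw [Finset.mem_filter] at hz
      have h1 := (hpow _ hz.1).2
      have h2 := hprod _ hz.1
      obtain ⟨hq, hr, -⟩ := h _ hz.1
      rw [hz.2] at h1 h2
      simp only [Finset.mem_product, Finset.mem_range, Finset.mem_biUnion, Finset.mem_Ioc,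
        Finset.mem_singleton] at h1 h2 hq hr ⊢
      refine ⟨by omega, q, by omega, rfl, by omega, Nat.le_floor ?_⟩
      have h3 : A * (a * max (q : ℝ) (A / a)) * (a * r) ≤ a ^ 2 * G := by
        refine le_trans ?_ h2
        rw [mul_max_of_nonneg _ _ ha0.le, mul_div_cancel₀ _ ha0.ne']
        gcongr
        exact le_max_left _ _
      have h4 : 0 < max (q : ℝ) (A / a) := lt_max_of_lt_right (by positivity)
      rw [div_mul_div_comm, mul_one, le_div_iff₀ (by positivity)]
      have h5 : a ^ 2 * (r * (A * max (q : ℝ) (A / a))) ≤ a ^ 2 * G := by linarith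
      exact le_of_mul_le_mul_left h5 (by positivity)
    have hc := (Finset.card_le_card hsub)
    rw [Finset.card_product, Finset.card_range] at hc
    have hc2 := (Nat.cast_le (α := ℝ)).2 (hc.trans (Nat.mul_le_mul_left _ Finset.card_biUnion_le))
    simp only [Finset.card_product, Finset.card_singleton, one_mul, Nat.card_Ioc,
      Nat.sub_zero] at hc2
    push_cast at hc2
    refine hc2.trans ?_
    calc 2 * 2 ^ k * ∑ q ∈ Finset.Ioc (0 : ℕ) (2 * 2 ^ k), (⌊G / A * (1 / max (q : ℝ) (A / a))⌋₊ : ℝ)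
        ≤ 2 * A * ∑ q ∈ Finset.Ioc (0 : ℕ) (2 * 2 ^ k), G / A * (1 / max (q : ℝ) (A / a)) := by
          gcongr with q hq
          exact Nat.floor_le (by positivity)
      _ = 2 * G * ∑ q ∈ Finset.Ioc (0 : ℕ) (2 * 2 ^ k), (1 / max (q : ℝ) (A / a)) := by
          rw [← Finset.mul_sum, ← mul_assoc]; congr 1; field_simp
      _ ≤ 2 * G * (2 * Real.log (1 + (2 * 2 ^ k : ℕ) / (A / a))) := by
          gcongr; exact sum_inv_max_le _ (by positivity)
      _ = 4 * G * Real.log (1 + 2 * a) := by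
          have : ((2 * 2 ^ k : ℕ) : ℝ) / (A / a) = 2 * a := by
            rw [Nat.cast_mul, Nat.cast_pow, Nat.cast_ofNat, ← hA]; field_simp
          rw [this]; ring
      _ ≤ 4 * G * Real.log (a ^ 2) := by
          have h1 : 1 + 2 * a ≤ a ^ 2 := by nlinarith
          gcongr
      _ = 8 * G * Real.log a := by rw [Real.log_pow]; push_cast; ring

/-- The three real roots of `X³ - aX² - (a+3)X - 1`, from the largest one along the cycle
`x ↦ -1 - 1/x`. -/
structure CubicRoots (a B m e : ℝ) : Prop where
  eight_le : 8 ≤ a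
  lt_big : a + 1 < B
  big_lt : B < a + 2
  sum_eq : B + m + e = a
  big_mul_mid : B * m = -1 - B
  mid_mul_small : m * e = -1 - m
  small_mul_big : e * B = -1 - e

namespace CubicRoots

variable {a B m e : ℝ} (h : CubicRoots a B m e)
include h

lemma small_neg : e < 0 := by
  have h1 := h.lt_big; have h2 := h.small_mul_big; have := h.eight_le
  nlinarith

lemma neg_one_lt_small_mul : -1 < e * (a + 2) := by
  have h1 := h.lt_big; have h2 := h.small_mul_big; have := h.eight_le; have := h.small_neg
  nlinarith

lemma neg_tenth_lt_small : -(1 / 10) < e := by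
  have h1 := h.neg_one_lt_small_mul; have := h.eight_le; have := h.small_neg
  nlinarith

lemma mid_lt : m < -1 := by
  have h1 := h.lt_big; have h2 := h.big_mul_mid; have := h.eight_le
  nlinarith

lemma lt_mid_mul : -1 < (m + 1) * (a + 1) := by
  have h1 := h.lt_big; have h2 := h.big_mul_mid; have := h.eight_le; have := h.mid_lt
  nlinarith

lemma lt_mid : -(9 / 8) < m := by
  have h1 := h.lt_mid_mul; have := h.eight_le; have := h.mid_lt
  nlinarith

lemma disc : (B - m) * (m - e) * (e - B) = a ^ 2 + 3 * a + 9 := by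
  have h1 : B ^ 2 * e + m ^ 2 * B + m * e ^ 2 = 3 := by
    linear_combination (B - 1) * h.small_mul_big + (m - 1) * h.big_mul_mid + (e - 1) * h.mid_mul_small
  have h2 : B ^ 2 * m + m ^ 2 * e + e ^ 2 * B = -(B + m + e) - (B ^ 2 + m ^ 2 + e ^ 2) := by
    linear_combination B * h.big_mul_mid + m * h.mid_mul_small + e * h.small_mul_big
  have h3 : B ^ 2 + m ^ 2 + e ^ 2 = (B + m + e) ^ 2 + 2 * (B + m + e) + 6 := by
    linear_combination (-2) * h.big_mul_mid - 2 * h.mid_mul_small - 2 * h.small_mul_big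
  rw [h3, h.sum_eq] at h2
  linear_combination h1 - h2

lemma prod_eq : B * m * e = 1 := by
  linear_combination e * h.big_mul_mid - h.small_mul_big

lemma pair_sum_eq : B * m + m * e + e * B = -(a + 3) := by
  linear_combination h.big_mul_mid + h.mid_mul_small + h.small_mul_big - h.sum_eq

lemma mid_sub_small : m - e = (B - m) * e := by
  linear_combination (-1 : ℝ) * h.small_mul_big + h.mid_mul_small

lemma small_sub_big : e - B = (m - e) * B := by
  linear_combination h.small_mul_big - h.big_mul_mid

lemma big_sub_mid : B - m = (e - B) * m := by
  linear_combination h.big_mul_mid - h.mid_mul_small 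

end CubicRoots

/-- Integral coordinates, embeddings and norms in the ring of integers of a simplest cubic field. -/
structure SimplestCubicModel (a : ℤ) (K : Type) [Field K] [NumberField K] where
  (B m e : ℝ)
  roots : CubicRoots a B m e
  (θ θ' : 𝓞 K)
  (s₁ s₂ s₃ : 𝓞 K →+* ℝ)
  s₁_θ : s₁ θ = B
  s₂_θ : s₂ θ = m
  s₃_θ : s₃ θ = e
  s₁_θ' : s₁ θ' = m
  s₂_θ' : s₂ θ' = e
  s₃_θ' : s₃ θ' = B
  span : ∀ z : 𝓞 K, ∃ p q r : ℤ, z = p + q * θ + r * θ'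
  norm : ∀ z : 𝓞 K, (Ideal.absNorm (Ideal.span {z}) : ℝ) = |s₁ z * s₂ z * s₃ z|

/-- The integral form attached to the index of `q θ + r θ'` vanishes only at the origin. -/
lemma indexForm_ne_zero (a : ℤ) : ∀ q r : ℤ, ¬ (q = 0 ∧ r = 0) →
    q ^ 3 + a * q ^ 2 * r - (a + 3) * q * r ^ 2 + r ^ 3 ≠ 0 := by
  have key : ∀ n : ℕ, ∀ q r : ℤ, q.natAbs + r.natAbs ≤ n → ¬ (q = 0 ∧ r = 0) →
      q ^ 3 + a * q ^ 2 * r - (a + 3) * q * r ^ 2 + r ^ 3 ≠ 0 := by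
    intro n
    induction n with
    | zero => intro q r h1 h2; omega
    | succ n ih =>
      intro q r h1 h2 h3
      have h4 : (2 : ℤ) ∣ q ∧ (2 : ℤ) ∣ r := by
        have h5 := congrArg Even h3
        simp only [Int.even_add, Int.even_sub, Int.even_mul, Int.even_pow, show Even (0 : ℤ) from ⟨0, rfl⟩,
          eq_iff_iff, iff_true] at h5
        rw [← even_iff_two_dvd, ← even_iff_two_dvd]
        by_cases e1 : Even q <;> by_cases e2 : Even r <;> by_cases e3 : Even a <;>
          simp_all (decide := true)
      obtain ⟨⟨q', rfl⟩, ⟨r', rfl⟩⟩ := h4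
      refine ih q' r' (by omega) (by omega) ?_
      have : (8 : ℤ) * (q' ^ 3 + a * q' ^ 2 * r' - (a + 3) * q' * r' ^ 2 + r' ^ 3) = 0 := by
        rw [← h3]; ring
      omega
  exact fun q r => key _ q r le_rfl

namespace SimplestCubicModel

variable {a : ℤ} {K : Type} [Field K] [NumberField K] (M : SimplestCubicModel a K)

/-- The same model with the embeddings permuted cyclically. -/
def rotate : SimplestCubicModel a K where
  B := M.B
  m := M.m
  e := M.e
  roots := M.roots
  θ := a - M.θ - M.θ'
  θ' := M.θ
  s₁ := M.s₂
  s₂ := M.s₃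
  s₃ := M.s₁
  s₁_θ := by simp [M.s₂_θ, M.s₂_θ']; linarith [M.roots.sum_eq]
  s₂_θ := by simp [M.s₃_θ, M.s₃_θ']; linarith [M.roots.sum_eq]
  s₃_θ := by simp [M.s₁_θ, M.s₁_θ']; linarith [M.roots.sum_eq]
  s₁_θ' := M.s₂_θ
  s₂_θ' := M.s₃_θ
  s₃_θ' := M.s₁_θ
  span z := by
    obtain ⟨p, q, r, rfl⟩ := M.span z
    exact ⟨p + r * a, -r, q - r, by push_cast; ring⟩
  norm z := by rw [M.norm]; congr 1; ring

lemma eq_zero_iff (z : 𝓞 K) : z = 0 ↔ M.s₁ z * M.s₂ z * M.s₃ z = 0 := by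
  rw [← abs_eq_zero (a := M.s₁ z * _ * _), ← M.norm, Nat.cast_eq_zero, Ideal.absNorm_eq_zero_iff,
    Ideal.span_singleton_eq_bot]

lemma s₁_ne_zero {z : 𝓞 K} (hz : z ≠ 0) : M.s₁ z ≠ 0 := fun h =>
  hz ((M.eq_zero_iff z).2 (by rw [h]; ring))

lemma s₁_injective : Function.Injective M.s₁ := fun x y hxy => by
  by_contra hne
  exact M.s₁_ne_zero (sub_ne_zero.2 hne) (by rw [map_sub, hxy, sub_self])

lemma abs_unit (u : (𝓞 K)ˣ) : |M.s₁ u * M.s₂ u * M.s₃ u| = 1 := by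
  rw [← M.norm, Ideal.span_singleton_eq_top.2 u.isUnit, Ideal.absNorm_top, Nat.cast_one]

lemma theta_mul : M.θ * (-1 - M.θ') = 1 := by
  apply M.s₁_injective
  simp only [map_mul, map_sub, map_neg, map_one, M.s₁_θ, M.s₁_θ']
  linarith [M.roots.big_mul_mid]

/-- `θ` as a unit. -/
def thetaUnit : (𝓞 K)ˣ :=
  ⟨M.θ, -1 - M.θ', M.theta_mul, by rw [mul_comm, M.theta_mul]⟩

section coordinates

variable (p q r : ℤ)

lemma s₁_coord : M.s₁ (p + q * M.θ + r * M.θ') = p + q * M.B + r * M.m := by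
  simp [M.s₁_θ, M.s₁_θ']

lemma s₂_coord : M.s₂ (p + q * M.θ + r * M.θ') = p + q * M.m + r * M.e := by
  simp [M.s₂_θ, M.s₂_θ']

lemma s₃_coord : M.s₃ (p + q * M.θ + r * M.θ') = p + q * M.e + r * M.B := by
  simp [M.s₃_θ, M.s₃_θ']

end coordinates

/-- The product of the differences of the conjugates of a non-rational integer is at least the
square root of the discriminant. -/
lemma le_abs_disc {z : 𝓞 K} (hz : ∀ n : ℤ, z ≠ n) : (a : ℝ) ^ 2 + 3 * a + 9 ≤
    |(M.s₁ z - M.s₂ z) * (M.s₂ z - M.s₃ z) * (M.s₃ z - M.s₁ z)| := by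
  obtain ⟨p, q, r, rfl⟩ := M.span z
  have hqr : ¬ (q = 0 ∧ r = 0) := by
    rintro ⟨rfl, rfl⟩
    exact hz p (by simp)
  rw [M.s₁_coord, M.s₂_coord, M.s₃_coord]
  have hR := M.roots
  have h1 : ((p : ℝ) + q * M.B + r * M.m) - (p + q * M.m + r * M.e) =
      (M.B - M.m) * (q + r * M.e) := by
    linear_combination (r : ℝ) * hR.mid_sub_small
  have h2 : ((p : ℝ) + q * M.m + r * M.e) - (p + q * M.e + r * M.B) =
      (M.m - M.e) * (q + r * M.B) := by
    linear_combination (r : ℝ) * hR.small_sub_big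
  have h3 : ((p : ℝ) + q * M.e + r * M.B) - (p + q * M.B + r * M.m) =
      (M.e - M.B) * (q + r * M.m) := by
    linear_combination (r : ℝ) * hR.big_sub_mid
  have h4 : ((q : ℝ) + r * M.e) * (q + r * M.B) * (q + r * M.m) =
      ((q ^ 3 + a * q ^ 2 * r - (a + 3) * q * r ^ 2 + r ^ 3 : ℤ) : ℝ) := by
    push_cast
    linear_combination (q : ℝ) ^ 2 * r * hR.sum_eq + (q : ℝ) * r ^ 2 * hR.pair_sum_eq +
      (r : ℝ) ^ 3 * hR.prod_eq
  rw [h1, h2, h3, show (M.B - M.m) * (q + r * M.e) * ((M.m - M.e) * (q + r * M.B)) *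
      ((M.e - M.B) * (q + r * M.m)) = ((M.B - M.m) * (M.m - M.e) * (M.e - M.B)) *
      (((q : ℝ) + r * M.e) * (q + r * M.B) * (q + r * M.m)) by ring, hR.disc, h4, abs_mul]
  have h5 : (1 : ℝ) ≤ |((q ^ 3 + a * q ^ 2 * r - (a + 3) * q * r ^ 2 + r ^ 3 : ℤ) : ℝ)| := by
    exact_mod_cast Int.one_le_abs (indexForm_ne_zero a q r hqr)
  have ha : (8 : ℝ) ≤ a := hR.eight_le
  rw [abs_of_pos (by positivity)]
  nlinarith [show (0 : ℝ) ≤ (a : ℝ) ^ 2 + 3 * a + 9 by positivity]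

end SimplestCubicModel

namespace CubicRoots

variable {a B m e : ℝ} (h : CubicRoots a B m e)
include h

lemma sq_sum_eq : B ^ 2 + m ^ 2 + e ^ 2 = a ^ 2 + 2 * a + 6 := by
  have h1 : (B + m + e) ^ 2 = a ^ 2 := by rw [h.sum_eq]
  linear_combination h1 - 2 * h.pair_sum_eq

/-- Coordinates are controlled by balanced conjugates: first coordinate direction. -/
lemma mul_abs_le {D₁ D₃ b₁ b₃ q r : ℝ} (h₁ : D₁ = q * (B - m) + r * (m - e))
    (h₃ : D₃ = -q * (m - e) + r * (B - e)) (hD₁ : |D₁| ≤ 2 * |b₁|) (hD₃ : |D₃| ≤ 2 * |b₃|)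
    (hb : |b₃| ≤ 3 * a * |b₁|) : a * |q| ≤ 10 * |b₁| := by
  have ha := h.eight_le; have hB := h.lt_big; have hm := h.mid_lt; have hm' := h.lt_mid
  have he := h.small_neg; have he' := h.neg_tenth_lt_small
  have hq : q * ((B - m) * (B - e) + (m - e) ^ 2) = D₁ * (B - e) - D₃ * (m - e) := by
    rw [h₁, h₃]; ring
  have hBe : a < B - e := by linarith
  have hdet : (B - e) * a ≤ (B - m) * (B - e) + (m - e) ^ 2 := by nlinarith
  have h4 : |q| * ((B - e) * a) ≤ 2 * |b₁| * (B - e) + 2 * |b₃| * (9 / 8) := by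
    calc _ ≤ |q| * ((B - m) * (B - e) + (m - e) ^ 2) := by gcongr
      _ = |D₁ * (B - e) - D₃ * (m - e)| := by
        rw [← hq, abs_mul, abs_of_nonneg (a := (B - m) * (B - e) + (m - e) ^ 2) (by nlinarith)]
      _ ≤ |D₁| * |B - e| + |D₃| * |m - e| := by
        rw [← abs_mul, ← abs_mul]; exact abs_sub _ _
      _ ≤ _ := by
        have : |m - e| ≤ 9 / 8 := by rw [abs_le]; constructor <;> linarith
        rw [abs_of_pos (show 0 < B - e by linarith)]
        gcongr
        linarith
  have h5 : (B - e) * (a * |q|) ≤ (B - e) * (10 * |b₁|) := by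
    have : a * |b₁| ≤ (B - e) * |b₁| := by gcongr
    have := abs_nonneg b₁
    nlinarith
  exact le_of_mul_le_mul_left h5 (by linarith)

lemma coord_bounds {p q r b₁ b₂ b₃ : ℝ} (h₁ : b₁ = p + q * B + r * m)
    (h₂ : b₂ = p + q * m + r * e) (h₃ : b₃ = p + q * e + r * B) (h21 : |b₂| ≤ |b₁|)
    (h23 : |b₂| ≤ |b₃|) (h12 : |b₁| ≤ 3 * a * |b₂|) (h32 : |b₃| ≤ 3 * a * |b₂|) :
    a * |q| ≤ 10 * |b₁| ∧ a * |r| ≤ 10 * |b₃| ∧ |q| ≤ 30 * |b₂| ∧ |r| ≤ 30 * |b₂| ∧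
      |p| ≤ 100 * |b₂| := by
  have ha := h.eight_le; have hB := h.lt_big; have hm := h.mid_lt; have hm' := h.lt_mid
  have he := h.small_neg; have he' := h.neg_tenth_lt_small
  have hD₁ : |b₁ - b₂| ≤ 2 * |b₁| := (abs_sub _ _).trans (by linarith)
  have hD₃ : |b₃ - b₂| ≤ 2 * |b₃| := (abs_sub _ _).trans (by linarith)
  have hq : a * |q| ≤ 10 * |b₁| := by
    refine h.mul_abs_le (D₁ := b₁ - b₂) (D₃ := b₃ - b₂) (r := r) ?_ ?_ hD₁ hD₃ ?_
    · rw [h₁, h₂]; ring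
    · rw [h₃, h₂]; ring
    · exact h32.trans (by gcongr)
  have hr : a * |r| ≤ 10 * |b₃| := by
    have hdet : 0 < (B - m) * (B - e) + (m - e) ^ 2 := by nlinarith
    have h4 : r * ((B - m) * (B - e) + (m - e) ^ 2) =
        (b₃ - b₂) * (B - m) + (b₁ - b₂) * (m - e) := by rw [h₁, h₂, h₃]; ring
    have hBm : a < B - m := by linarith
    have hme : |m - e| ≤ 9 / 8 := by rw [abs_le]; constructor <;> linarith
    have hb : |b₁| ≤ 3 * a * |b₃| := h12.trans (by gcongr)
    have h5 : |r| * ((B - m) * a) ≤ 2 * |b₃| * (B - m) + 2 * |b₁| * (9 / 8) := by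
      calc _ ≤ |r| * ((B - m) * (B - e) + (m - e) ^ 2) := by gcongr; nlinarith
        _ = |(b₃ - b₂) * (B - m) + (b₁ - b₂) * (m - e)| := by
          rw [← h4, abs_mul, abs_of_pos hdet]
        _ ≤ |b₃ - b₂| * |B - m| + |b₁ - b₂| * |m - e| := by
          rw [← abs_mul, ← abs_mul]; exact abs_add_le _ _
        _ ≤ _ := by
          rw [abs_of_pos (show 0 < B - m by linarith)]
          gcongr
          linarith
    have h6 : (B - m) * (a * |r|) ≤ (B - m) * (10 * |b₃|) := by
      have : a * |b₃| ≤ (B - m) * |b₃| := by gcongr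
      have := abs_nonneg b₃
      nlinarith
    exact le_of_mul_le_mul_left h6 (by linarith)
  have hq' : |q| ≤ 30 * |b₂| := le_of_mul_le_mul_left (hq.trans (by linarith)) (by linarith : 0 < a)
  have hr' : |r| ≤ 30 * |b₂| := le_of_mul_le_mul_left (hr.trans (by linarith)) (by linarith : 0 < a)
  refine ⟨hq, hr, hq', hr', ?_⟩
  have : p = b₂ - q * m - r * e := by rw [h₂]; ring
  calc |p| = |b₂ - q * m - r * e| := by rw [← this]
    _ ≤ |b₂| + |q| * |m| + |r| * |e| := by
      rw [← abs_mul, ← abs_mul]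
      exact (abs_sub _ _).trans (add_le_add_left (abs_sub _ _) _)
    _ ≤ |b₂| + (30 * |b₂|) * (9 / 8) + (30 * |b₂|) * (1 / 10) := by
      have h1 : |m| ≤ 9 / 8 := by rw [abs_le]; constructor <;> linarith
      have h2 : |e| ≤ 1 / 10 := by rw [abs_le]; constructor <;> linarith
      gcongr
    _ ≤ _ := by linarith [abs_nonneg b₂]

end CubicRoots

namespace SimplestCubicModel

variable {a : ℤ} {K : Type} [Field K] [NumberField K] (M : SimplestCubicModel a K)

/-- The sum of the squares of the conjugates. -/
def sqSum (z : 𝓞 K) : ℝ := M.s₁ z ^ 2 + M.s₂ z ^ 2 + M.s₃ z ^ 2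

lemma exists_nat_sqSum (z : 𝓞 K) : ∃ n : ℕ, M.sqSum z = n := by
  obtain ⟨p, q, r, rfl⟩ := M.span z
  have key : M.sqSum (p + q * M.θ + r * M.θ') = ((3 * p ^ 2 + (q ^ 2 + r ^ 2) * (a ^ 2 + 2 * a + 6) +
      2 * p * (q + r) * a - 2 * q * r * (a + 3) : ℤ) : ℝ) := by
    rw [sqSum, M.s₁_coord, M.s₂_coord, M.s₃_coord]
    push_cast
    linear_combination ((q : ℝ) ^ 2 + r ^ 2) * M.roots.sq_sum_eq +
      2 * (p : ℝ) * (q + r) * M.roots.sum_eq + 2 * (q : ℝ) * r * M.roots.pair_sum_eq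
  have h0 : 0 ≤ M.sqSum (p + q * M.θ + r * M.θ') := by unfold sqSum; positivity
  rw [key] at h0 ⊢
  obtain ⟨n, hn⟩ := Int.eq_ofNat_of_zero_le (by exact_mod_cast h0)
  exact ⟨n, by rw [hn]; simp⟩

/-- An integer is reduced if no unit multiple has smaller conjugates in the square mean. -/
def IsReduced (w : 𝓞 K) : Prop := ∀ v : (𝓞 K)ˣ, M.sqSum w ≤ M.sqSum (w * v)

lemma exists_isReduced (z : 𝓞 K) : ∃ u : (𝓞 K)ˣ, M.IsReduced (z * u) := by
  classical
  have hex : ∃ n : ℕ, ∃ u : (𝓞 K)ˣ, M.sqSum (z * u) = n :=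
    (M.exists_nat_sqSum (z * (1 : (𝓞 K)ˣ))).imp fun n hn => ⟨1, hn⟩
  obtain ⟨u, hu⟩ := Nat.find_spec hex
  refine ⟨u, fun v => ?_⟩
  obtain ⟨n, hn⟩ := M.exists_nat_sqSum (z * u * v)
  rw [hu, hn]
  exact_mod_cast Nat.find_min' hex ⟨u * v, by rw [← hn, Units.val_mul, mul_assoc]⟩

variable {M} {w : 𝓞 K}

lemma IsReduced.rotate (hw : M.IsReduced w) : M.rotate.IsReduced w := by
  have key : ∀ z, M.rotate.sqSum z = M.sqSum z := fun z => by
    simp only [sqSum, SimplestCubicModel.rotate]; ring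
  intro v
  rw [key, key]
  exact hw v

lemma IsReduced.sq_s₁_le (hw : M.IsReduced w) : M.s₁ w ^ 2 ≤ 4 * (a : ℝ) ^ 2 * M.s₃ w ^ 2 := by
  have h := hw M.thetaUnit⁻¹
  have hval : ((M.thetaUnit⁻¹ : (𝓞 K)ˣ) : 𝓞 K) = -1 - M.θ' := rfl
  simp only [sqSum, hval, map_mul, map_sub, map_neg, map_one, M.s₁_θ', M.s₂_θ', M.s₃_θ',
    mul_pow] at h
  have hR := M.roots
  have ha := hR.eight_le; have hB := hR.lt_big; have hB' := hR.big_lt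
  have hm := hR.mid_lt; have hm' := hR.lt_mid
  have he := hR.small_neg; have he' := hR.neg_tenth_lt_small
  have h1 : (-1 - M.m) ^ 2 ≤ 1 / 64 := by nlinarith
  have h2 : (-1 - M.e) ^ 2 ≤ 1 := by nlinarith
  have h3 : (-1 - M.B) ^ 2 ≤ 3 * (a : ℝ) ^ 2 := by nlinarith
  have e1 := mul_le_mul_of_nonneg_left h1 (sq_nonneg (M.s₁ w))
  have e2 := mul_le_mul_of_nonneg_left h2 (sq_nonneg (M.s₂ w))
  have e3 := mul_le_mul_of_nonneg_left h3 (sq_nonneg (M.s₃ w))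
  nlinarith [sq_nonneg (M.s₁ w), sq_nonneg (M.s₃ w)]

lemma IsReduced.sq_s₃_le (hw : M.IsReduced w) : M.s₃ w ^ 2 ≤ 9 * (a : ℝ) ^ 2 * M.s₁ w ^ 2 := by
  have h := hw M.thetaUnit
  have hval : (M.thetaUnit : 𝓞 K) = M.θ := rfl
  have h21 : M.s₂ w ^ 2 ≤ 4 * (a : ℝ) ^ 2 * M.s₁ w ^ 2 := hw.rotate.sq_s₁_le
  simp only [sqSum, hval, map_mul, M.s₁_θ, M.s₂_θ, M.s₃_θ, mul_pow] at h
  have hR := M.roots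
  have ha := hR.eight_le; have hB := hR.lt_big; have hB' := hR.big_lt
  have hm := hR.mid_lt; have hm' := hR.lt_mid; have hm'' := hR.lt_mid_mul
  have he := hR.small_neg; have he' := hR.neg_tenth_lt_small
  have h1 : M.B ^ 2 ≤ 2 * (a : ℝ) ^ 2 := by nlinarith
  have h2 : (M.m ^ 2 - 1) * (4 * (a : ℝ) ^ 2) ≤ 3 * (a : ℝ) ^ 2 := by
    have : M.m ^ 2 - 1 ≤ 3 / 4 := by nlinarith
    nlinarith [sq_nonneg (a : ℝ)]
  have h3 : M.e ^ 2 ≤ 1 / 100 := by nlinarith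
  have h4 : 0 ≤ M.m ^ 2 - 1 := by nlinarith
  have e1 := mul_le_mul_of_nonneg_left h1 (sq_nonneg (M.s₁ w))
  have e2 := mul_le_mul_of_nonneg_left h21 h4
  have e3 := mul_le_mul_of_nonneg_left h3 (sq_nonneg (M.s₃ w))
  have e4 := mul_le_mul_of_nonneg_left h2 (sq_nonneg (M.s₁ w))
  nlinarith [sq_nonneg (M.s₁ w), sq_nonneg (M.s₃ w)]

lemma IsReduced.abs_s₁_le (hw : M.IsReduced w) : |M.s₁ w| ≤ 3 * a * |M.s₃ w| := by
  have ha := M.roots.eight_le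
  refine abs_le_of_sq_le_sq' ?_ (by positivity) |> abs_le.2
  rw [mul_pow, sq_abs]
  nlinarith [hw.sq_s₁_le, mul_nonneg (sq_nonneg (a : ℝ)) (sq_nonneg (M.s₃ w))]

lemma IsReduced.abs_s₃_le (hw : M.IsReduced w) : |M.s₃ w| ≤ 3 * a * |M.s₁ w| := by
  have ha := M.roots.eight_le
  refine abs_le_of_sq_le_sq' ?_ (by positivity) |> abs_le.2
  rw [mul_pow, sq_abs]
  nlinarith [hw.sq_s₃_le]

lemma IsReduced.coord_le (hw : M.IsReduced w) (h21 : |M.s₂ w| ≤ |M.s₁ w|)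
    (h23 : |M.s₂ w| ≤ |M.s₃ w|) {p q r : ℤ} (hpqr : w = p + q * M.θ + r * M.θ') :
    ((max p.natAbs (max q.natAbs r.natAbs) : ℕ) : ℝ) *
      max ((a : ℝ) * q.natAbs) (max p.natAbs (max q.natAbs r.natAbs) : ℕ) *
      max ((a : ℝ) * r.natAbs) (max p.natAbs (max q.natAbs r.natAbs) : ℕ) ≤
      10 ^ 6 * Ideal.absNorm (Ideal.span {w}) := by
  obtain ⟨h1, h2, h3, h4, h5⟩ := M.roots.coord_bounds (p := p) (q := q) (r := r)
    (b₁ := M.s₁ w) (b₂ := M.s₂ w) (b₃ := M.s₃ w)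
    (by rw [hpqr, M.s₁_coord]) (by rw [hpqr, M.s₂_coord]) (by rw [hpqr, M.s₃_coord])
    h21 h23 hw.rotate.abs_s₃_le hw.rotate.rotate.abs_s₁_le
  have habs : ∀ n : ℤ, ((n.natAbs : ℕ) : ℝ) = |(n : ℝ)| := fun n => by
    rw [← Int.cast_abs, Nat.cast_natAbs]
  have ha := M.roots.eight_le
  have hb := abs_nonneg (M.s₂ w)
  have hmax : ((max p.natAbs (max q.natAbs r.natAbs) : ℕ) : ℝ) ≤ 100 * |M.s₂ w| := by
    push_cast
    rw [habs, habs, habs]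
    refine max_le h5 (max_le ?_ ?_) <;> linarith
  rw [M.norm, abs_mul, abs_mul, habs q, habs r]
  calc _ ≤ 100 * |M.s₂ w| * (100 * |M.s₁ w|) * (100 * |M.s₃ w|) := by
        gcongr
        · exact max_le (by linarith [abs_nonneg (M.s₁ w)]) (by linarith)
        · exact max_le (by linarith [abs_nonneg (M.s₃ w)]) (by linarith)
    _ = _ := by ring

variable (M)

/-- The three models obtained by permuting the embeddings cyclically. -/
def rot (k : Fin 3) : SimplestCubicModel a K := ![M, M.rotate, M.rotate.rotate] k

/-- Every integer has an associate with balanced coordinates in one of the three models. -/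
lemma exists_coord (z : 𝓞 K) : ∃ (k : Fin 3) (p q r : ℤ),
    Ideal.span {z} = Ideal.span {p + q * (M.rot k).θ + r * (M.rot k).θ'} ∧
    ((max p.natAbs (max q.natAbs r.natAbs) : ℕ) : ℝ) *
      max ((a : ℝ) * q.natAbs) (max p.natAbs (max q.natAbs r.natAbs) : ℕ) *
      max ((a : ℝ) * r.natAbs) (max p.natAbs (max q.natAbs r.natAbs) : ℕ) ≤
      10 ^ 6 * Ideal.absNorm (Ideal.span {z}) := by
  obtain ⟨u, hu⟩ := M.exists_isReduced z
  have hspan : Ideal.span {z} = Ideal.span {z * (u : 𝓞 K)} :=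
    (Ideal.span_singleton_mul_right_unit u.isUnit z).symm
  rw [hspan]
  have key : ∃ k : Fin 3, (M.rot k).IsReduced (z * u) ∧
      |(M.rot k).s₂ (z * u)| ≤ |(M.rot k).s₁ (z * u)| ∧
      |(M.rot k).s₂ (z * u)| ≤ |(M.rot k).s₃ (z * u)| := by
    rcases le_total |M.s₁ (z * u)| |M.s₂ (z * u)| with h12 | h12 <;>
    rcases le_total |M.s₁ (z * u)| |M.s₃ (z * u)| with h13 | h13 <;>
    rcases le_total |M.s₂ (z * u)| |M.s₃ (z * u)| with h23 | h23
    · exact ⟨2, hu.rotate.rotate, h13, h12⟩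
    · exact ⟨2, hu.rotate.rotate, h13, h12⟩
    · exact ⟨1, hu.rotate, h13.trans h12, h13⟩
    · exact ⟨1, hu.rotate, h23, h13⟩
    · exact ⟨0, hu, h12, h23⟩
    · exact ⟨1, hu.rotate, h23, h23.trans h12⟩
    · exact ⟨0, hu, h12, h23⟩
    · exact ⟨1, hu.rotate, h23, h13⟩
  obtain ⟨k, hk, h1, h2⟩ := key
  obtain ⟨p, q, r, hpqr⟩ := (M.rot k).span (z * u)
  exact ⟨k, p, q, r, by rw [← hpqr], hk.coord_le h1 h2 hpqr⟩

/-- The nonzero primitive principal ideals of norm at most `x`. -/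
def primitiveIdeals (K : Type) [Field K] [NumberField K] (x : ℝ) : Set (Ideal (𝓞 K)) :=
  {I | I ≠ ⊥ ∧ Submodule.IsPrincipal I ∧ (Ideal.absNorm I : ℝ) ≤ x ∧
    ∀ n : ℤ, 2 ≤ n → ¬ I ≤ Ideal.span {(n : 𝓞 K)}}

/-- The principal ideal with given signs and absolute values of the coordinates. -/
def coordIdeal (c : Fin 3 × (ℤˣ × ℤˣ × ℤˣ) × (ℕ × ℕ × ℕ)) : Ideal (𝓞 K) :=
  Ideal.span {(((c.2.1.1 : ℤ) * c.2.2.1 : ℤ) : 𝓞 K) +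
    (((c.2.1.2.1 : ℤ) * c.2.2.2.1 : ℤ) : 𝓞 K) * (M.rot c.1).θ +
    (((c.2.1.2.2 : ℤ) * c.2.2.2.2 : ℤ) : 𝓞 K) * (M.rot c.1).θ'}

lemma exists_units_mul_natAbs (n : ℤ) : ∃ u : ℤˣ, (u : ℤ) * n.natAbs = n := by
  rcases Int.natAbs_eq n with h | h
  · exact ⟨1, by rw [Units.val_one, one_mul]; exact h.symm⟩
  · exact ⟨-1, by rw [Units.val_neg, Units.val_one, neg_one_mul]; exact h.symm⟩

/-- Absolute values of the coordinates of balanced generators of primitive ideals. -/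
noncomputable def coordFinset (a x : ℝ) : Finset (ℕ × ℕ × ℕ) := by
  classical
  exact (Finset.range (⌊10 ^ 6 * x⌋₊ + 1) ×ˢ Finset.range (⌊10 ^ 6 * x⌋₊ + 1) ×ˢ
    Finset.range (⌊10 ^ 6 * x⌋₊ + 1)).filter fun z =>
      (z.2.1 = 0 ∧ z.2.2 = 0 → z.1 = 1) ∧
      ((max z.1 (max z.2.1 z.2.2) : ℕ) : ℝ) * max (a * z.2.1) (max z.1 (max z.2.1 z.2.2) : ℕ) *
        max (a * z.2.2) (max z.1 (max z.2.1 z.2.2) : ℕ) ≤ 10 ^ 6 * x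


lemma natAbs_eq_one_of_span_mem {x : ℝ} {p : ℤ}
    (h : Ideal.span {(p : 𝓞 K)} ∈ primitiveIdeals K x) : p.natAbs = 1 := by
  obtain ⟨h1, -, -, h4⟩ := h
  have h0 : p ≠ 0 := by
    rintro rfl
    exact h1 (by simp)
  by_contra hne
  refine h4 |p| (by rw [Int.abs_eq_natAbs]; omega) ?_
  rw [Ideal.span_singleton_le_span_singleton]
  exact Int.cast_dvd_cast _ _ (abs_dvd_self p)

lemma primitiveIdeals_subset (x : ℝ) : primitiveIdeals K x ⊆
    ((Finset.univ ×ˢ Finset.univ ×ˢ coordFinset a x).image M.coordIdeal : Set (Ideal (𝓞 K))) := by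
  intro I hI
  obtain ⟨z, rfl⟩ : ∃ z, I = Ideal.span {z} := hI.2.1.principal
  obtain ⟨k, p, q, r, hspan, hle⟩ := M.exists_coord z
  obtain ⟨u, hu⟩ := exists_units_mul_natAbs p
  obtain ⟨v, hv⟩ := exists_units_mul_natAbs q
  obtain ⟨w, hw⟩ := exists_units_mul_natAbs r
  have ha := M.roots.eight_le
  have hle' := hle.trans (mul_le_mul_of_nonneg_left hI.2.2.1 (by positivity : (0 : ℝ) ≤ 10 ^ 6))
  have hmax : max p.natAbs (max q.natAbs r.natAbs) ≤ ⌊10 ^ 6 * x⌋₊ := by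
    set N := max p.natAbs (max q.natAbs r.natAbs) with hN
    rcases Nat.eq_zero_or_pos N with h0 | h0
    · omega
    have h1 : (1 : ℝ) ≤ N := by exact_mod_cast h0
    refine Nat.le_floor (le_trans ?_ hle')
    calc (N : ℝ) = N * 1 * 1 := by ring
      _ ≤ _ := by
        gcongr
        · exact h1.trans (le_max_right _ _)
        · exact h1.trans (le_max_right _ _)
  rw [Finset.coe_image]
  refine ⟨(k, (u, v, w), p.natAbs, q.natAbs, r.natAbs), ?_, ?_⟩
  · simp only [Finset.coe_product, Set.mem_prod, Finset.coe_univ, Set.mem_univ, true_and,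
      Finset.mem_coe, coordFinset, Finset.mem_filter, Finset.mem_product, Finset.mem_range]
    refine ⟨⟨by omega, by omega, by omega⟩, ?_, hle'⟩
    rintro ⟨hq, hr⟩
    rw [Int.natAbs_eq_zero] at hq hr
    subst hq hr
    refine natAbs_eq_one_of_span_mem (x := x) (K := K) ?_
    rw [hspan] at hI
    simpa using hI
  · rw [coordIdeal, hspan]
    simp only [hu, hv, hw]

lemma finite_primitiveIdeals (M : SimplestCubicModel a K) (x : ℝ) : (primitiveIdeals K x).Finite :=
  (Finset.finite_toSet _).subset (M.primitiveIdeals_subset x)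

lemma ncard_primitiveIdeals_le_card (M : SimplestCubicModel a K) (x : ℝ) :
    (primitiveIdeals K x).ncard ≤ 24 * (coordFinset a x).card := by
  refine (Set.ncard_le_ncard (M.primitiveIdeals_subset x) (Finset.finite_toSet _)).trans ?_
  rw [Set.ncard_coe_finset]
  refine Finset.card_image_le.trans ?_
  simp only [Finset.card_product, Finset.card_univ, Fintype.card_fin, Fintype.card_prod,
    Fintype.card_units_int]
  omega

end SimplestCubicModel

namespace SimplestCubicModel

lemma card_pairs_mul_le (s : Finset (ℕ × ℕ)) {a x : ℝ} (ha : 8 ≤ a) (hx : 0 < x)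
    (h : ∀ z ∈ s, 1 ≤ z.2 ∧ (max z.1 z.2 : ℕ) * (a * z.2) * (max z.1 z.2 : ℕ) ≤ 10 ^ 6 * x) :
    (s.card : ℝ) ≤ 4 * (10 ^ 4 * (x / a) ^ ((2 : ℝ) / 3)) := by
  have h0 : 0 ≤ x / a := by positivity
  set w : ℝ := 100 * (x / a) ^ ((1 : ℝ) / 3) with hw
  have hw2 : w ^ 2 = 10 ^ 4 * (x / a) ^ ((2 : ℝ) / 3) := by
    rw [hw, mul_pow, ← Real.rpow_natCast ((x / a) ^ _), ← Real.rpow_mul h0]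
    norm_num
  have hw3 : w ^ 3 = 10 ^ 6 * x / a := by
    rw [hw, mul_pow, ← Real.rpow_natCast ((x / a) ^ _), ← Real.rpow_mul h0]
    norm_num
    ring
  rw [← hw2]
  have hw0 : 0 ≤ w := by positivity
  refine card_pairs_le s hw0 fun z hz => ?_
  obtain ⟨h1, h2⟩ := h z hz
  have h3 : ((max z.1 z.2 : ℕ) : ℝ) ^ 2 * z.2 ≤ w ^ 3 := by
    rw [hw3, le_div_iff₀ (by linarith)]
    linarith
  have h4 : (z.1 : ℝ) ≤ (max z.1 z.2 : ℕ) := by exact_mod_cast le_max_left _ _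
  have h5 : (z.2 : ℝ) ≤ (max z.1 z.2 : ℕ) := by exact_mod_cast le_max_right _ _
  refine ⟨h1, ?_, le_trans (by gcongr) h3⟩
  refine le_of_pow_le_pow_left₀ three_ne_zero hw0 (le_trans ?_ h3)
  rw [pow_succ]
  gcongr

lemma card_coordFinset_le {a x : ℝ} (ha : 8 ≤ a) (hx : 0 < x) :
    ((coordFinset a x).card : ℝ) ≤ 1 + 8 * (10 ^ 4 * (x / a) ^ ((2 : ℝ) / 3)) +
      26 * (10 ^ 6 * x / a ^ 2) * Real.log a ^ 2 := by
  classical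
  set S := coordFinset a x with hS
  have hmem : ∀ z ∈ S, (z.2.1 = 0 ∧ z.2.2 = 0 → z.1 = 1) ∧
      ((max z.1 (max z.2.1 z.2.2) : ℕ) : ℝ) * max (a * z.2.1) (max z.1 (max z.2.1 z.2.2) : ℕ) *
        max (a * z.2.2) (max z.1 (max z.2.1 z.2.2) : ℕ) ≤ 10 ^ 6 * x := fun z hz => by
    rw [hS, coordFinset, Finset.mem_filter] at hz
    exact hz.2
  set S₁ := S.filter fun z => z.2.2 = 0 ∧ 1 ≤ z.2.1 with hS₁
  set S₂ := S.filter fun z => z.2.1 = 0 ∧ 1 ≤ z.2.2 with hS₂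
  set S₃ := S.filter fun z => 1 ≤ z.2.1 ∧ 1 ≤ z.2.2 with hS₃
  have hsub : S ⊆ {(1, 0, 0)} ∪ S₁ ∪ S₂ ∪ S₃ := by
    rintro ⟨p, q, r⟩ hz
    have := (hmem _ hz).1
    simp only [Finset.mem_union, Finset.mem_singleton, hS₁, hS₂, hS₃, Finset.mem_filter, hz,
      true_and, Prod.mk.injEq]
    dsimp only at this
    omega
  have hcard : (S.card : ℝ) ≤ 1 + S₁.card + S₂.card + S₃.card := by
    have h1 := Finset.card_le_card hsub
    have h2 := Finset.card_union_le ({(1, 0, 0)} ∪ S₁ ∪ S₂) S₃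
    have h3 := Finset.card_union_le ({(1, 0, 0)} ∪ S₁) S₂
    have h4 := Finset.card_union_le {(1, 0, 0)} S₁
    rw [Finset.card_singleton] at h4
    exact_mod_cast (by omega : S.card ≤ 1 + S₁.card + S₂.card + S₃.card)
  have hc₁ : (S₁.card : ℝ) ≤ 4 * (10 ^ 4 * (x / a) ^ ((2 : ℝ) / 3)) := by
    have hinj : Set.InjOn (fun z : ℕ × ℕ × ℕ => (z.1, z.2.1)) S₁ := by
      rintro ⟨p, q, r⟩ hz ⟨p', q', r'⟩ hz' h
      simp only [hS₁, Finset.coe_filter, Set.mem_ofPred_eq] at hz hz'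
      simp only [Prod.mk.injEq] at h ⊢
      exact ⟨h.1, h.2, hz.2.1.trans hz'.2.1.symm⟩
    rw [← Finset.card_image_of_injOn hinj]
    refine card_pairs_mul_le _ ha hx fun z hz => ?_
    obtain ⟨⟨p, q, r⟩, hz', rfl⟩ := Finset.mem_image.1 hz
    rw [hS₁, Finset.mem_filter] at hz'
    obtain ⟨hzS, hr, hq⟩ := hz'
    have h := (hmem _ hzS).2
    dsimp only at h hr hq ⊢
    subst hr
    rw [Nat.max_zero] at h
    refine ⟨hq, le_trans ?_ h⟩
    gcongr
    · exact le_max_left _ _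
    · exact le_max_right _ _
  have hc₂ : (S₂.card : ℝ) ≤ 4 * (10 ^ 4 * (x / a) ^ ((2 : ℝ) / 3)) := by
    have hinj : Set.InjOn (fun z : ℕ × ℕ × ℕ => (z.1, z.2.2)) S₂ := by
      rintro ⟨p, q, r⟩ hz ⟨p', q', r'⟩ hz' h
      simp only [hS₂, Finset.coe_filter, Set.mem_ofPred_eq] at hz hz'
      simp only [Prod.mk.injEq] at h ⊢
      exact ⟨h.1, hz.2.1.trans hz'.2.1.symm, h.2⟩
    rw [← Finset.card_image_of_injOn hinj]
    refine card_pairs_mul_le _ ha hx fun z hz => ?_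
    obtain ⟨⟨p, q, r⟩, hz', rfl⟩ := Finset.mem_image.1 hz
    rw [hS₂, Finset.mem_filter] at hz'
    obtain ⟨hzS, hq, hr⟩ := hz'
    have h := (hmem _ hzS).2
    dsimp only at h hr hq ⊢
    subst hq
    rw [Nat.zero_max, mul_right_comm] at h
    refine ⟨hr, le_trans ?_ h⟩
    gcongr
    · exact le_max_left _ _
    · exact le_max_right _ _
  have hc₃ : (S₃.card : ℝ) ≤ 26 * (10 ^ 6 * x / a ^ 2) * Real.log a ^ 2 := by
    refine card_triples_le S₃ ha (by positivity) fun z hz => ?_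
    rw [hS₃, Finset.mem_filter] at hz
    refine ⟨hz.2.1, hz.2.2, ((hmem z hz.1).2).trans_eq ?_⟩
    field_simp
  linarith

lemma ncard_primitiveIdeals_le {a : ℤ} {K : Type} [Field K] [NumberField K]
    (M : SimplestCubicModel a K) {x : ℝ} (hx : 0 < x) : ((primitiveIdeals K x).ncard : ℝ) ≤
      10 ^ 9 * (Real.log a ^ 2 * x / (a : ℝ) ^ 2 + (x / a) ^ ((2 : ℝ) / 3) + 1) := by
  have ha := M.roots.eight_le
  have h1 := card_coordFinset_le ha hx
  have h2 : ((primitiveIdeals K x).ncard : ℝ) ≤ 24 * (coordFinset a x).card := by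
    exact_mod_cast M.ncard_primitiveIdeals_le_card x
  have h3 : 0 ≤ (x / a) ^ ((2 : ℝ) / 3) := by positivity
  have h4 : 0 ≤ Real.log a ^ 2 * x / (a : ℝ) ^ 2 := by positivity
  have h5 : 26 * (10 ^ 6 * x / (a : ℝ) ^ 2) * Real.log a ^ 2 =
      26 * 10 ^ 6 * (Real.log a ^ 2 * x / (a : ℝ) ^ 2) := by ring
  linarith

end SimplestCubicModel

namespace SimplestCubicModel

variable {a : ℤ} {K : Type} [Field K] [NumberField K] (M : SimplestCubicModel a K)

lemma coord_eq_zero {p q r : ℤ} (h : p + q * M.θ + r * M.θ' = 0) : p = 0 ∧ q = 0 ∧ r = 0 := by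
  have h1 := congrArg M.s₁ h
  have h2 := congrArg M.s₂ h
  have h3 := congrArg M.s₃ h
  rw [M.s₁_coord, map_zero] at h1
  rw [M.s₂_coord, map_zero] at h2
  rw [M.s₃_coord, map_zero] at h3
  have hR := M.roots
  have ha := hR.eight_le; have hB := hR.lt_big; have hm := hR.mid_lt
  have he := hR.small_neg
  have hdet : (M.B - M.m) * (M.B - M.e) + (M.m - M.e) ^ 2 ≠ 0 := by nlinarith
  have hq : (q : ℝ) = 0 := by
    refine (mul_eq_zero.1 ?_).resolve_right hdet
    linear_combination (h1 - h2) * (M.B - M.e) - (h3 - h2) * (M.m - M.e)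
  have hr : (r : ℝ) = 0 := by
    refine (mul_eq_zero.1 ?_).resolve_right hdet
    linear_combination (h3 - h2) * (M.B - M.m) + (h1 - h2) * (M.m - M.e)
  have hp : (p : ℝ) = 0 := by rw [hq, hr] at h1; linarith
  exact ⟨by exact_mod_cast hp, by exact_mod_cast hq, by exact_mod_cast hr⟩

lemma coord_injective {p q r p' q' r' : ℤ}
    (h : (p + q * M.θ + r * M.θ' : 𝓞 K) = p' + q' * M.θ + r' * M.θ') :
    p = p' ∧ q = q' ∧ r = r' := by
  have := M.coord_eq_zero (p := p - p') (q := q - q') (r := r - r')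
    (by push_cast; linear_combination h)
  omega

lemma dvd_coord {n p q r : ℤ} (h : (n : 𝓞 K) ∣ p + q * M.θ + r * M.θ') :
    n ∣ p ∧ n ∣ q ∧ n ∣ r := by
  obtain ⟨z, hz⟩ := h
  obtain ⟨p', q', r', rfl⟩ := M.span z
  obtain ⟨rfl, rfl, rfl⟩ := M.coord_injective (p' := n * p') (q' := n * q') (r' := n * r')
    (hz.trans (by push_cast; ring))
  exact ⟨dvd_mul_right _ _, dvd_mul_right _ _, dvd_mul_right _ _⟩

/-- A unit whose conjugates have comparable absolute values is `1` or `-1`. -/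
lemma unit_eq_one_or {ε : (𝓞 K)ˣ} {κ : ℝ} (hκ : 8 * κ < (a : ℝ) ^ 2 + 3 * a + 9)
    (h12 : |M.s₁ ε| ≤ κ * |M.s₂ ε|) (h21 : |M.s₂ ε| ≤ κ * |M.s₁ ε|)
    (h13 : |M.s₁ ε| ≤ κ * |M.s₃ ε|) (h31 : |M.s₃ ε| ≤ κ * |M.s₁ ε|)
    (h23 : |M.s₂ ε| ≤ κ * |M.s₃ ε|) (h32 : |M.s₃ ε| ≤ κ * |M.s₂ ε|) :
    (ε : 𝓞 K) = 1 ∨ (ε : 𝓞 K) = -1 := by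
  have hprod := M.abs_unit ε
  rw [abs_mul, abs_mul] at hprod
  by_cases hn : ∃ n : ℤ, (ε : 𝓞 K) = n
  · obtain ⟨n, hn⟩ := hn
    rw [hn] at hprod
    simp only [map_intCast] at hprod
    have h3 : |n| * |n| * |n| = 1 := by exact_mod_cast hprod
    have h1 : |n| = 1 := by
      rcases Int.eq_one_or_neg_one_of_mul_eq_one ((mul_comm _ _).trans h3) with h | h
      · exact h
      · have := abs_nonneg n; omega
    rcases (abs_eq zero_le_one).1 h1 with rfl | rfl
    · left; simpa using hn
    · right; simpa using hn
  · have hdisc := M.le_abs_disc (z := ε) (by push Not at hn; exact hn)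
    rw [abs_mul, abs_mul] at hdisc
    generalize M.s₁ ε = x at *
    generalize M.s₂ ε = y at *
    generalize M.s₃ ε = z at *
    have hle : |x - y| * |y - z| * |z - x| ≤ (|x| + |y|) * (|y| + |z|) * (|z| + |x|) := by
      gcongr <;> exact abs_sub _ _
    have hx := abs_nonneg x
    have hy := abs_nonneg y
    have hz := abs_nonneg z
    generalize |x| = x at *
    generalize |y| = y at *
    generalize |z| = z at *
    have hκ1 : 1 ≤ κ := by
      by_contra hlt
      push Not at hlt
      rcases lt_or_ge κ 0 with h0 | h0
      · have : x = 0 := by nlinarith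
        rw [this] at hprod
        norm_num at hprod
      · have hxy : 0 < x * y := by
          rcases (mul_nonneg hx hy).eq_or_lt with h | h
          · rw [← h] at hprod; norm_num at hprod
          · exact h
        have hx0 : 0 < x := (pos_and_pos_or_neg_and_neg_of_mul_pos hxy).elim
          (fun h => h.1) (fun h => absurd h.1 (not_lt.2 hx))
        nlinarith
    nlinarith [mul_le_mul_of_nonneg_left h12 (mul_nonneg hx hz),
      mul_le_mul_of_nonneg_left h21 (mul_nonneg hy hz),
      mul_le_mul_of_nonneg_left h13 (mul_nonneg hx hy),
      mul_le_mul_of_nonneg_left h31 (mul_nonneg hz hy),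
      mul_le_mul_of_nonneg_left h23 (mul_nonneg hy hx),
      mul_le_mul_of_nonneg_left h32 (mul_nonneg hz hx)]

/-- The conjugates of `z` lie in prescribed intervals up to a scaling factor. -/
structure Balanced (l₁ l₂ l₃ u₁ u₂ u₃ : ℝ) (z : 𝓞 K) (t : ℝ) : Prop where
  pos : 0 < t
  le₁ : l₁ * t ≤ |M.s₁ z|
  le₂ : l₂ * t ≤ M.s₂ z
  le₃ : l₃ * t ≤ |M.s₃ z|
  ge₁ : |M.s₁ z| ≤ u₁ * t
  ge₂ : M.s₂ z ≤ u₂ * t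
  ge₃ : |M.s₃ z| ≤ u₃ * t

lemma ratio_le {l l' u u' κ t t' x x' y y' : ℝ} (hl : 0 < l) (hl' : 0 < l')
    (h : u * u' ≤ κ * (l * l')) (ht : 0 < t) (ht' : 0 < t') (hx : l * t ≤ |x|) (hx2 : |x'| ≤ u' * t)
    (hx' : l' * t ≤ |x'|) (hy : |x * y| ≤ u * t') (hy' : l' * t' ≤ |x' * y'|) (hκ : 0 ≤ κ) :
    |y| ≤ κ * |y'| := by
  have h1 : 0 < |x| * |x'| := mul_pos ((mul_pos hl ht).trans_le hx) ((mul_pos hl' ht).trans_le hx')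
  refine le_of_mul_le_mul_left ?_ h1
  calc |x| * |x'| * |y| = |x * y| * |x'| := by rw [abs_mul]; ring
    _ ≤ u * t' * (u' * t) := by gcongr; exact (abs_nonneg _).trans hy
    _ = u * u' * (t * t') := by ring
    _ ≤ κ * (l * l') * (t * t') := by gcongr
    _ = κ * ((l * t) * (l' * t')) := by ring
    _ ≤ κ * (|x| * |x' * y'|) := by gcongr
    _ = |x| * |x'| * (κ * |y'|) := by rw [abs_mul]; ring

variable {M} in
lemma Balanced.eq_of_span_eq {l₁ l₂ l₃ u₁ u₂ u₃ κ : ℝ} {z z' : 𝓞 K} {t t' : ℝ}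
    (hz : M.Balanced l₁ l₂ l₃ u₁ u₂ u₃ z t) (hz' : M.Balanced l₁ l₂ l₃ u₁ u₂ u₃ z' t')
    (h₁ : 0 < l₁) (h₂ : 0 < l₂) (h₃ : 0 < l₃) (hκ : 0 ≤ κ) (h12 : u₁ * u₂ ≤ κ * (l₁ * l₂))
    (h13 : u₁ * u₃ ≤ κ * (l₁ * l₃)) (h23 : u₂ * u₃ ≤ κ * (l₂ * l₃))
    (hκa : 8 * κ < (a : ℝ) ^ 2 + 3 * a + 9) (h : Ideal.span {z} = Ideal.span {z'}) : z = z' := by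
  obtain ⟨ε, rfl⟩ := Ideal.span_singleton_eq_span_singleton.1 h
  have hp := (mul_pos h₂ hz.pos).trans_le hz.le₂
  have hp' := (mul_pos h₂ hz'.pos).trans_le hz'.le₂
  have a1 := hz.le₁; have a2 := hz.le₂; have a3 := hz.le₃
  have b1 := hz.ge₁; have b2 := hz.ge₂; have b3 := hz.ge₃
  have a1' := hz'.le₁; have a2' := hz'.le₂; have a3' := hz'.le₃
  have b1' := hz'.ge₁; have b2' := hz'.ge₂; have b3' := hz'.ge₃
  rw [← abs_of_pos hp] at a2 b2
  rw [← abs_of_pos hp'] at a2' b2'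
  rw [map_mul] at a1' a2' a3' b1' b2' b3'
  have h21 : u₂ * u₁ ≤ κ * (l₂ * l₁) := by linarith
  have h31 : u₃ * u₁ ≤ κ * (l₃ * l₁) := by linarith
  have h32 : u₃ * u₂ ≤ κ * (l₃ * l₂) := by linarith
  have ht := hz.pos
  have ht' := hz'.pos
  rcases M.unit_eq_one_or hκa (ratio_le h₁ h₂ h12 ht ht' a1 b2 a2 b1' a2' hκ)
    (ratio_le h₂ h₁ h21 ht ht' a2 b1 a1 b2' a1' hκ) (ratio_le h₁ h₃ h13 ht ht' a1 b3 a3 b1' a3' hκ)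
    (ratio_le h₃ h₁ h31 ht ht' a3 b1 a1 b3' a1' hκ) (ratio_le h₂ h₃ h23 ht ht' a2 b3 a3 b2' a3' hκ)
    (ratio_le h₃ h₂ h32 ht ht' a3 b2 a2 b3' a2' hκ) with h | h
  · rw [h, mul_one]
  · rw [h, mul_neg, mul_one, map_neg] at hp'
    linarith

/-- A family of balanced elements with coprime coordinates gives distinct primitive ideals. -/
lemma card_le_ncard_primitiveIdeals {ι : Type*} (S : Finset ι) (p q r : ι → ℤ) (t : ι → ℝ)
    {l₁ l₂ l₃ u₁ u₂ u₃ κ x : ℝ} (h₁ : 0 < l₁) (h₂ : 0 < l₂) (h₃ : 0 < l₃) (hκ : 0 ≤ κ)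
    (h12 : u₁ * u₂ ≤ κ * (l₁ * l₂)) (h13 : u₁ * u₃ ≤ κ * (l₁ * l₃))
    (h23 : u₂ * u₃ ≤ κ * (l₂ * l₃)) (hκa : 8 * κ < (a : ℝ) ^ 2 + 3 * a + 9)
    (hbal : ∀ i ∈ S, M.Balanced l₁ l₂ l₃ u₁ u₂ u₃ (p i + q i * M.θ + r i * M.θ') (t i))
    (hnorm : ∀ i ∈ S, |M.s₁ (p i + q i * M.θ + r i * M.θ')| * M.s₂ (p i + q i * M.θ + r i * M.θ') *
      |M.s₃ (p i + q i * M.θ + r i * M.θ')| ≤ x)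
    (hprim : ∀ i ∈ S, ∀ n : ℤ, n ∣ p i → n ∣ q i → n ∣ r i → n ∣ 1)
    (hinj : ∀ i ∈ S, ∀ j ∈ S, p i = p j → q i = q j → r i = r j → i = j) :
    S.card ≤ (primitiveIdeals K x).ncard := by
  classical
  have hinj' : Set.InjOn (fun i => Ideal.span {(p i + q i * M.θ + r i * M.θ' : 𝓞 K)}) S := by
    intro i hi j hj hij
    obtain ⟨hp, hq, hr⟩ := M.coord_injective
      ((hbal i hi).eq_of_span_eq (hbal j hj) h₁ h₂ h₃ hκ h12 h13 h23 hκa hij)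
    exact hinj i hi j hj hp hq hr
  rw [← Finset.card_image_of_injOn hinj', ← Set.ncard_coe_finset]
  refine Set.ncard_le_ncard ?_ (M.finite_primitiveIdeals x)
  rw [Finset.coe_image]
  rintro _ ⟨i, hi, rfl⟩
  have hs₂ := (mul_pos h₂ (hbal i hi).pos).trans_le (hbal i hi).le₂
  refine ⟨?_, ⟨_, rfl⟩, ?_, fun n hn hle => ?_⟩
  · rw [Ne, Ideal.span_singleton_eq_bot]
    intro h0
    rw [h0, map_zero] at hs₂
    exact lt_irrefl _ hs₂
  · rw [M.norm, abs_mul, abs_mul, abs_of_pos hs₂]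
    exact hnorm i hi
  · obtain ⟨hp, hq, hr⟩ := M.dvd_coord (Ideal.span_singleton_le_span_singleton.1 hle)
    have := Int.le_of_dvd one_pos (hprim i hi n hp hq hr)
    omega

lemma one_le_ncard_primitiveIdeals (M : SimplestCubicModel a K) {x : ℝ} (hx : 1 ≤ x) :
    1 ≤ (primitiveIdeals K x).ncard := by
  rw [Nat.one_le_iff_ne_zero, Ne, Set.ncard_eq_zero (M.finite_primitiveIdeals x)]
  refine Set.Nonempty.ne_empty ⟨⊤, top_ne_bot, inferInstance, by simpa using hx, fun n hn hle => ?_⟩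
  have h1 : (n : 𝓞 K) ∣ ((1 : ℤ) : 𝓞 K) + ((0 : ℤ) : 𝓞 K) * M.θ + ((0 : ℤ) : 𝓞 K) * M.θ' :=
    Ideal.mem_span_singleton.1 (hle trivial)
  have := Int.le_of_dvd one_pos (M.dvd_coord h1).1
  omega

end SimplestCubicModel

lemma exists_nat_cube {y : ℝ} (hy : 1 ≤ y) :
    ∃ n : ℕ, 1 ≤ n ∧ (n : ℝ) ^ 3 ≤ y ∧ y ≤ 8 * (n : ℝ) ^ 3 := by
  have h0 : 0 ≤ y := by linarith
  set c := y ^ ((1 : ℝ) / 3) with hc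
  have hc3 : c ^ 3 = y := by
    rw [hc, ← Real.rpow_natCast, ← Real.rpow_mul h0]
    norm_num
  have hc1 : 1 ≤ c := Real.one_le_rpow hy (by norm_num)
  have hn : 1 ≤ ⌊c⌋₊ := Nat.le_floor (by simpa using hc1)
  have hn' : (1 : ℝ) ≤ ⌊c⌋₊ := by exact_mod_cast hn
  refine ⟨⌊c⌋₊, hn, ?_, ?_⟩
  · rw [← hc3]
    gcongr
    exact Nat.floor_le (by linarith)
  · rw [← hc3, show (8 : ℝ) * (⌊c⌋₊ : ℝ) ^ 3 = (2 * ⌊c⌋₊) ^ 3 by ring]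
    gcongr
    linarith [Nat.lt_floor_add_one c]

lemma dvd_one_of_gcd_eq_one {k q r : ℕ} (h : Nat.gcd k (Nat.gcd q r) = 1) {n : ℤ}
    (hk : n ∣ k) (hq : n ∣ q) (hr : n ∣ r) : n ∣ 1 := by
  have h1 : n.natAbs ∣ Nat.gcd k (Nat.gcd q r) :=
    Nat.dvd_gcd (Int.natAbs_dvd_natAbs.2 hk)
      (Nat.dvd_gcd (Int.natAbs_dvd_natAbs.2 hq) (Int.natAbs_dvd_natAbs.2 hr))
  rw [h] at h1
  exact Int.natAbs_dvd.1 (Int.natCast_dvd_natCast.2 h1)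

namespace SimplestCubicModel

variable {a : ℤ} {K : Type} [Field K] [NumberField K] (M : SimplestCubicModel a K)

variable {M} in
lemma Balanced.norm_le {l₁ l₂ l₃ u₁ u₂ u₃ t : ℝ} {z : 𝓞 K}
    (h : M.Balanced l₁ l₂ l₃ u₁ u₂ u₃ z t) (hl : 0 < l₂) :
    |M.s₁ z| * M.s₂ z * |M.s₃ z| ≤ u₁ * u₂ * u₃ * t ^ 3 := by
  have h0 := (mul_pos hl h.pos).trans_le h.le₂
  calc _ ≤ u₁ * t * (u₂ * t) * (u₃ * t) := by
        refine mul_le_mul (mul_le_mul h.ge₁ h.ge₂ h0.le ((abs_nonneg _).trans h.ge₁)) h.ge₃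
          (abs_nonneg _) (mul_nonneg ((abs_nonneg _).trans h.ge₁) (h0.le.trans h.ge₂))
    _ = _ := by ring

lemma sq_le_ncard_primitiveIdeals (M : SimplestCubicModel a K) {x : ℝ} {N : ℕ}
    (hN : 104 * a * (N : ℝ) ^ 3 ≤ x) :
    (N : ℝ) ^ 2 / 4 ≤ (primitiveIdeals K x).ncard := by
  refine (card_coprime_pairs N).trans ?_
  have hR := M.roots
  have ha := hR.eight_le; have hB := hR.lt_big; have hB' := hR.big_lt
  have hm := hR.mid_lt; have hm' := hR.lt_mid
  have he := hR.small_neg; have he' := hR.neg_tenth_lt_small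
  have hbal : ∀ i j : ℕ, 0 < i → 0 < j → M.Balanced (M.B - 3) (2 - M.m) (2 - M.e) (M.B - 2)
      (3 - M.m) (3 - M.e) (((2 * i + 3 * j : ℤ) : 𝓞 K) + ((-(i + j) : ℤ) : 𝓞 K) * M.θ +
        ((0 : ℤ) : 𝓞 K) * M.θ') (i + j) := by
    intro i j hi hj
    have hi' : (0 : ℝ) < i := by exact_mod_cast hi
    have hj' : (0 : ℝ) < j := by exact_mod_cast hj
    have h₁ : |M.s₁ (((2 * i + 3 * j : ℤ) : 𝓞 K) + ((-(i + j) : ℤ) : 𝓞 K) * M.θ +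
        ((0 : ℤ) : 𝓞 K) * M.θ')| = i * (M.B - 2) + j * (M.B - 3) := by
      rw [M.s₁_coord, abs_of_neg]
      · push_cast; ring
      · push_cast; nlinarith
    have h₂ : M.s₂ (((2 * i + 3 * j : ℤ) : 𝓞 K) + ((-(i + j) : ℤ) : 𝓞 K) * M.θ +
        ((0 : ℤ) : 𝓞 K) * M.θ') = i * (2 - M.m) + j * (3 - M.m) := by
      rw [M.s₂_coord]
      push_cast; ring
    have h₃ : |M.s₃ (((2 * i + 3 * j : ℤ) : 𝓞 K) + ((-(i + j) : ℤ) : 𝓞 K) * M.θ +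
        ((0 : ℤ) : 𝓞 K) * M.θ')| = i * (2 - M.e) + j * (3 - M.e) := by
      rw [M.s₃_coord, abs_of_pos]
      · push_cast; ring
      · push_cast; nlinarith
    refine ⟨by positivity, ?_, ?_, ?_, ?_, ?_, ?_⟩ <;> simp only [h₁, h₂, h₃] <;> linarith
  norm_cast
  refine M.card_le_ncard_primitiveIdeals _ (fun z => 2 * z.1 + 3 * z.2) (fun z => -(z.1 + z.2))
    (fun _ => 0) (fun z => z.1 + z.2) (κ := 2) (l₁ := M.B - 3) (l₂ := 2 - M.m) (l₃ := 2 - M.e)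
    (u₁ := M.B - 2) (u₂ := 3 - M.m) (u₃ := 3 - M.e) (by linarith) (by linarith) (by linarith)
    (by norm_num) (by nlinarith) (by nlinarith) (by nlinarith) (by nlinarith) ?_ ?_ ?_ ?_
  · rintro ⟨i, j⟩ hz
    simp only [Finset.mem_filter, Finset.mem_product, Finset.mem_Ioc] at hz
    exact hbal i j hz.1.1.1 hz.1.2.1
  · rintro ⟨i, j⟩ hz
    simp only [Finset.mem_filter, Finset.mem_product, Finset.mem_Ioc] at hz
    have hb := hbal i j hz.1.1.1 hz.1.2.1
    have hi : (i : ℝ) ≤ N := by exact_mod_cast hz.1.1.2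
    have hj : (j : ℝ) ≤ N := by exact_mod_cast hz.1.2.2
    have ht := hb.pos.le
    have hprod : (M.B - 2) * (3 - M.m) * (3 - M.e) ≤ 13 * a := by
      calc _ ≤ (a : ℝ) * (33 / 8) * (31 / 10) := by
            gcongr <;> linarith
        _ ≤ _ := by linarith
    calc _ ≤ (M.B - 2) * (3 - M.m) * (3 - M.e) * ((i : ℝ) + j) ^ 3 := hb.norm_le (by linarith)
      _ ≤ 13 * a * (2 * N) ^ 3 := by gcongr; linarith
      _ ≤ x := by linarith
  · rintro ⟨i, j⟩ hz n h1 h2 -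
    simp only [Finset.mem_filter] at hz
    have h4 : n ∣ (i : ℤ) := by
      have := (h2.mul_left 3).add h1
      ring_nf at this
      simpa using this.neg_right
    have h5 : n ∣ (j : ℤ) := by
      have := (h2.mul_left 2).add h1
      ring_nf at this
      exact this
    exact dvd_one_of_gcd_eq_one (q := j) (r := j) (by rw [Nat.gcd_self]; exact hz.2) h4 h5 h5
  · rintro ⟨i, j⟩ - ⟨i', j'⟩ - h1 h2 -
    dsimp only at h1 h2
    rw [Prod.mk.injEq]
    omega

lemma cube_le_ncard_primitiveIdeals (M : SimplestCubicModel a K) {x : ℝ} {N : ℕ}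
    (hN : (210 * a * (N : ℝ)) ^ 3 ≤ x) :
    3 / 8 * (N : ℝ) ^ 3 ≤ (primitiveIdeals K x).ncard := by
  rw [show (N : ℝ) ^ 3 = N * N * N by ring]
  refine (card_coprime_triples N N N).trans ?_
  have hR := M.roots
  have ha := hR.eight_le; have hB := hR.lt_big; have hB' := hR.big_lt
  have hm := hR.mid_lt; have hm' := hR.lt_mid
  have he := hR.small_neg; have he' := hR.neg_tenth_lt_small
  have hbal : ∀ k q r : ℕ, 0 < k → 0 < q → 0 < r → M.Balanced (49 / 50) (49 / 50) (49 / 50)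
      (51 / 50) (51 / 50) (51 / 50) (((k + 100 * a * (q + r) : ℤ) : 𝓞 K) + ((q : ℤ) : 𝓞 K) * M.θ +
        ((r : ℤ) : 𝓞 K) * M.θ') (k + 100 * a * (q + r)) := by
    intro k q r hk hq hr
    have hk' : (0 : ℝ) < k := by exact_mod_cast hk
    have hq' : (0 : ℝ) < q := by exact_mod_cast hq
    have hr' : (0 : ℝ) < r := by exact_mod_cast hr
    have hq1 := mul_le_mul_of_nonneg_left ha hq'.le
    have hr1 := mul_le_mul_of_nonneg_left ha hr'.le
    have g1 := mul_le_mul_of_nonneg_left hB.le hq'.le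
    have g2 := mul_le_mul_of_nonneg_left hB'.le hq'.le
    have g3 := mul_le_mul_of_nonneg_left hB.le hr'.le
    have g4 := mul_le_mul_of_nonneg_left hB'.le hr'.le
    have g5 := mul_le_mul_of_nonneg_left hm.le hq'.le
    have g6 := mul_le_mul_of_nonneg_left hm'.le hq'.le
    have g7 := mul_le_mul_of_nonneg_left hm.le hr'.le
    have g8 := mul_le_mul_of_nonneg_left hm'.le hr'.le
    have g9 := mul_le_mul_of_nonneg_left he.le hq'.le
    have g10 := mul_le_mul_of_nonneg_left he'.le hq'.le
    have g11 := mul_le_mul_of_nonneg_left he.le hr'.le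
    have g12 := mul_le_mul_of_nonneg_left he'.le hr'.le
    refine ⟨by positivity, le_trans ?_ (le_abs_self _), ?_, le_trans ?_ (le_abs_self _),
      abs_le.2 ⟨?_, ?_⟩, ?_, abs_le.2 ⟨?_, ?_⟩⟩ <;>
      (simp only [M.s₁_coord, M.s₂_coord, M.s₃_coord]; push_cast; linarith)
  norm_cast
  refine M.card_le_ncard_primitiveIdeals _ (fun z => z.1 + 100 * a * (z.2.1 + z.2.2))
    (fun z => z.2.1) (fun z => z.2.2) (fun z => z.1 + 100 * a * (z.2.1 + z.2.2)) (κ := 2)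
    (l₁ := 49 / 50) (l₂ := 49 / 50) (l₃ := 49 / 50) (u₁ := 51 / 50) (u₂ := 51 / 50)
    (u₃ := 51 / 50) (by norm_num) (by norm_num) (by norm_num) (by norm_num) (by norm_num)
    (by norm_num) (by norm_num) (by nlinarith) ?_ ?_ ?_ ?_
  · rintro ⟨k, q, r⟩ hz
    simp only [Finset.mem_filter, Finset.mem_product, Finset.mem_Ioc] at hz
    exact hbal k q r hz.1.1.1 hz.1.2.1.1 hz.1.2.2.1
  · rintro ⟨k, q, r⟩ hz
    simp only [Finset.mem_filter, Finset.mem_product, Finset.mem_Ioc] at hz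
    have hb := hbal k q r hz.1.1.1 hz.1.2.1.1 hz.1.2.2.1
    have hk : (k : ℝ) ≤ N := by exact_mod_cast hz.1.1.2
    have hq : (q : ℝ) ≤ N := by exact_mod_cast hz.1.2.1.2
    have hr : (r : ℝ) ≤ N := by exact_mod_cast hz.1.2.2.2
    have ht := hb.pos.le
    have hN0 : (0 : ℝ) ≤ N := Nat.cast_nonneg N
    have ht' : (51 / 50 : ℝ) * (k + 100 * a * (q + r)) ≤ 210 * a * N := by
      have h1 : 100 * (a : ℝ) * (q + r) ≤ 100 * a * (N + N) := by gcongr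
      nlinarith
    calc _ ≤ 51 / 50 * (51 / 50) * (51 / 50) * (k + 100 * a * (q + r) : ℝ) ^ 3 :=
          hb.norm_le (by norm_num)
      _ = (51 / 50 * (k + 100 * a * (q + r)) : ℝ) ^ 3 := by ring
      _ ≤ (210 * a * N) ^ 3 := by gcongr
      _ ≤ x := hN
  · rintro ⟨k, q, r⟩ hz n h1 h2 h3
    simp only [Finset.mem_filter] at hz
    exact dvd_one_of_gcd_eq_one hz.2.1
      ((Int.dvd_add_left ((h2.add h3).mul_left (100 * a))).1 h1) h2 h3
  · rintro ⟨k, q, r⟩ - ⟨k', q', r'⟩ - h1 h2 h3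
    dsimp only at h1 h2 h3
    rw [h2, h3] at h1
    simp only [Prod.mk.injEq]
    omega

end SimplestCubicModel

namespace SimplestCubicModel

variable {a : ℤ} {K : Type} [Field K] [NumberField K] (M : SimplestCubicModel a K)

section skew

variable {p q r : ℕ} {T : ℝ} (hT : 1 ≤ T) (hq0 : 0 < q) (hr0 : 0 < r) (hpq : 8 * (q : ℝ) ≤ p)
  (hpr : 8 * (r : ℝ) ≤ p) (hqp : p ≤ 8 * T * q) (hrp : p ≤ 8 * T * r)
include hT hq0 hr0 hpq hpr hqp hrp

lemma balanced_of_ratio : M.Balanced (a / (8 * T)) (1 / 2) (a / (8 * T)) a 1 a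
    (((p : ℤ) : 𝓞 K) + ((q : ℤ) : 𝓞 K) * M.θ + ((r : ℤ) : 𝓞 K) * M.θ') p := by
  have hR := M.roots
  have ha := hR.eight_le; have hB := hR.lt_big; have hB' := hR.big_lt
  have hm := hR.mid_lt; have hm' := hR.lt_mid
  have he := hR.small_neg; have he' := hR.neg_tenth_lt_small
  have hq' : (0 : ℝ) < q := by exact_mod_cast hq0
  have hr' : (0 : ℝ) < r := by exact_mod_cast hr0
  have g1 := mul_le_mul_of_nonneg_left hB.le hq'.le
  have g2 := mul_le_mul_of_nonneg_left hB'.le hq'.le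
  have g3 := mul_le_mul_of_nonneg_left hB.le hr'.le
  have g4 := mul_le_mul_of_nonneg_left hB'.le hr'.le
  have g5 := mul_le_mul_of_nonneg_left hm.le hq'.le
  have g6 := mul_le_mul_of_nonneg_left hm'.le hq'.le
  have g7 := mul_le_mul_of_nonneg_left hm.le hr'.le
  have g8 := mul_le_mul_of_nonneg_left hm'.le hr'.le
  have g9 := mul_le_mul_of_nonneg_left he.le hq'.le
  have g10 := mul_le_mul_of_nonneg_left he'.le hq'.le
  have g11 := mul_le_mul_of_nonneg_left he.le hr'.le
  have g12 := mul_le_mul_of_nonneg_left he'.le hr'.le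
  have k1 : a / (8 * T) * p ≤ q * a := by
    rw [div_mul_eq_mul_div, div_le_iff₀ (by positivity)]
    nlinarith
  have k2 : a / (8 * T) * p ≤ r * a := by
    rw [div_mul_eq_mul_div, div_le_iff₀ (by positivity)]
    nlinarith
  have k3 := mul_le_mul_of_nonneg_left hpq (show (0 : ℝ) ≤ a by linarith)
  have k4 := mul_le_mul_of_nonneg_left hpr (show (0 : ℝ) ≤ a by linarith)
  have k5 := mul_le_mul_of_nonneg_right ha (Nat.cast_nonneg (α := ℝ) p)
  have k6 : 0 ≤ (a : ℝ) * q := by positivity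
  have k7 : 0 ≤ (a : ℝ) * r := by positivity
  refine ⟨by linarith, le_trans ?_ (le_abs_self _), ?_, le_trans ?_ (le_abs_self _),
    abs_le.2 ⟨?_, ?_⟩, ?_, abs_le.2 ⟨?_, ?_⟩⟩ <;>
    (simp only [M.s₁_coord, M.s₂_coord, M.s₃_coord]; push_cast; linarith)

lemma norm_le_of_ratio (hTa : 8 * T ≤ a) :
    |M.s₁ (((p : ℤ) : 𝓞 K) + ((q : ℤ) : 𝓞 K) * M.θ + ((r : ℤ) : 𝓞 K) * M.θ')| *
      M.s₂ (((p : ℤ) : 𝓞 K) + ((q : ℤ) : 𝓞 K) * M.θ + ((r : ℤ) : 𝓞 K) * M.θ') *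
      |M.s₃ (((p : ℤ) : 𝓞 K) + ((q : ℤ) : 𝓞 K) * M.θ + ((r : ℤ) : 𝓞 K) * M.θ')| ≤
      9 * (a : ℝ) ^ 2 * ((p : ℝ) * q * r) := by
  have hb := M.balanced_of_ratio hT hq0 hr0 hpq hpr hqp hrp
  have hR := M.roots
  have ha := hR.eight_le; have hB := hR.lt_big; have hB' := hR.big_lt
  have hm := hR.mid_lt; have hm' := hR.lt_mid
  have he := hR.small_neg; have he' := hR.neg_tenth_lt_small
  have hq' : (0 : ℝ) < q := by exact_mod_cast hq0
  have hr' : (0 : ℝ) < r := by exact_mod_cast hr0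
  have k1 : (p : ℝ) ≤ a * q := hqp.trans (by gcongr)
  have k2 : (p : ℝ) ≤ a * r := hrp.trans (by gcongr)
  have h₁ : |M.s₁ (((p : ℤ) : 𝓞 K) + ((q : ℤ) : 𝓞 K) * M.θ + ((r : ℤ) : 𝓞 K) * M.θ')| ≤
      3 * a * q := by
    rw [M.s₁_coord, abs_le]
    push_cast
    constructor <;> nlinarith
  have h₃ : |M.s₃ (((p : ℤ) : 𝓞 K) + ((q : ℤ) : 𝓞 K) * M.θ + ((r : ℤ) : 𝓞 K) * M.θ')| ≤
      3 * a * r := by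
    rw [M.s₃_coord, abs_le]
    push_cast
    constructor <;> nlinarith
  have h₂ := hb.ge₂
  have h0 := (mul_pos one_half_pos hb.pos).trans_le hb.le₂
  calc _ ≤ 3 * (a : ℝ) * q * (1 * p) * (3 * a * r) :=
        mul_le_mul (mul_le_mul h₁ h₂ h0.le (by positivity)) h₃ (abs_nonneg _) (by positivity)
    _ = _ := by ring

end skew

lemma pow_le_of_ratio {i i' p q : ℕ} (h : p < 8 * 64 ^ i * q)
    (h' : 64 ^ i' * q < 8 * p) : i' ≤ i := by
  by_contra hlt
  push Not at hlt
  have h1 : (64 : ℕ) ^ (i + 1) ≤ 64 ^ i' := Nat.pow_le_pow_right (by norm_num) hlt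
  have h2 : 64 ^ (i + 1) * q ≤ 64 ^ i' * q := Nat.mul_le_mul_right q h1
  rw [pow_succ] at h2
  linarith

lemma log_sq_le_ncard_primitiveIdeals (M : SimplestCubicModel a K) {x X : ℝ} {J : ℕ} (hJ : 1 ≤ J)
    (hJa : (64 : ℝ) ^ (4 * J) ≤ a) (hX : a ≤ X) (hx : 9 * (a : ℝ) ^ 2 * X ≤ x) :
    (J : ℝ) ^ 2 * (3 / 64 * X) ≤ (primitiveIdeals K x).ncard := by
  classical
  have ha := M.roots.eight_le
  have hn : ∀ ij : ℕ × ℕ, ∃ n : ℕ, ij ∈ Finset.Icc 1 J ×ˢ Finset.Icc 1 J → 1 ≤ n ∧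
      (n : ℝ) ^ 3 * 64 ^ (2 * (ij.1 + ij.2)) ≤ X ∧
      X ≤ 8 * ((n : ℝ) ^ 3 * 64 ^ (2 * (ij.1 + ij.2))) := by
    rintro ⟨i, j⟩
    by_cases hij : (i, j) ∈ Finset.Icc 1 J ×ˢ Finset.Icc 1 J
    · simp only [Finset.mem_product, Finset.mem_Icc] at hij
      have hpow : (64 : ℝ) ^ (2 * (i + j)) ≤ X :=
        (pow_le_pow_right₀ (by norm_num) (by omega)).trans (hJa.trans hX)
      obtain ⟨n, h1, h2, h3⟩ := exists_nat_cube ((one_le_div (by positivity)).2 hpow)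
      refine ⟨n, fun _ => ⟨h1, ?_, ?_⟩⟩
      · rwa [le_div_iff₀ (by positivity)] at h2
      · rwa [div_le_iff₀ (by positivity), mul_assoc] at h3
    · exact ⟨0, fun h => absurd h hij⟩
  choose n hn using hn
  set F : ℕ × ℕ → Finset (ℕ × ℕ × ℕ) := fun ij =>
    (Finset.Ioc 0 (64 ^ (ij.1 + ij.2) * n ij) ×ˢ Finset.Ioc 0 (64 ^ ij.2 * n ij) ×ˢ
      Finset.Ioc 0 (64 ^ ij.1 * n ij)).filter fun z : ℕ × ℕ × ℕ =>
        Nat.gcd z.1 (Nat.gcd z.2.1 z.2.2) = 1 ∧ 64 ^ (ij.1 + ij.2) * n ij < 8 * z.1 ∧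
          64 ^ ij.2 * n ij < 8 * z.2.1 ∧ 64 ^ ij.1 * n ij < 8 * z.2.2 with hF
  have hcard : ∀ ij ∈ Finset.Icc 1 J ×ˢ Finset.Icc 1 J, 3 / 64 * X ≤ (F ij).card := by
    intro ij hij
    refine le_trans ?_ (card_coprime_triples _ _ _)
    have := (hn ij hij).2.2
    push_cast
    have e : (64 : ℝ) ^ (2 * (ij.1 + ij.2)) = 64 ^ (ij.1 + ij.2) * 64 ^ ij.2 * 64 ^ ij.1 := by ring
    rw [e] at this
    linarith
  have hsum : (J : ℝ) ^ 2 * (3 / 64 * X) ≤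
      ((Finset.Icc 1 J ×ˢ Finset.Icc 1 J).sigma F).card := by
    rw [Finset.card_sigma]
    push_cast
    refine le_trans (le_of_eq ?_) (Finset.card_nsmul_le_sum _ _ _ hcard)
    rw [Finset.card_product, Nat.card_Icc, nsmul_eq_mul]
    push_cast
    ring
  refine hsum.trans ?_
  set T : ℝ := 64 ^ J with hT
  have hT1 : 64 ≤ T := by
    calc (64 : ℝ) = 64 ^ 1 := by norm_num
      _ ≤ T := pow_le_pow_right₀ (by norm_num) hJ
  have hTa : T ^ 4 ≤ a := by rw [hT, ← pow_mul, mul_comm J 4]; exact hJa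
  have hT2 : 512 * T ^ 2 ≤ a := by
    have h1 : 512 ≤ T ^ 2 := by nlinarith
    calc 512 * T ^ 2 ≤ T ^ 2 * T ^ 2 := by gcongr
      _ = T ^ 4 := by ring
      _ ≤ a := hTa
  have hT8 : 8 * T ≤ a := by nlinarith
  have hmem : ∀ z ∈ (Finset.Icc 1 J ×ˢ Finset.Icc 1 J).sigma F,
      0 < z.2.2.1 ∧ 0 < z.2.2.2 ∧ 8 * (z.2.2.1 : ℝ) ≤ z.2.1 ∧ 8 * (z.2.2.2 : ℝ) ≤ z.2.1 ∧
      z.2.1 ≤ 8 * T * z.2.2.1 ∧ z.2.1 ≤ 8 * T * z.2.2.2 ∧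
      (z.2.1 : ℝ) * z.2.2.1 * z.2.2.2 ≤ X ∧ Nat.gcd z.2.1 (Nat.gcd z.2.2.1 z.2.2.2) = 1 ∧
      z.2.1 < 8 * 64 ^ z.1.1 * z.2.2.1 ∧ 64 ^ z.1.1 * z.2.2.1 < 8 * z.2.1 ∧
      z.2.1 < 8 * 64 ^ z.1.2 * z.2.2.2 ∧ 64 ^ z.1.2 * z.2.2.2 < 8 * z.2.1 := by
    rintro ⟨⟨i, j⟩, p, q, r⟩ hz
    rw [Finset.mem_sigma] at hz
    have hX' := (hn _ hz.1).2.1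
    simp only [hF, Finset.mem_product, Finset.mem_Icc, Finset.mem_filter, Finset.mem_Ioc] at hz hX'
    obtain ⟨⟨⟨hi, hiJ⟩, hj, hjJ⟩, ⟨⟨hp0, hp⟩, ⟨hq0, hq⟩, hr0, hr⟩, hgcd, hp', hq', hr'⟩ := hz
    dsimp only
    generalize n (i, j) = N at *
    have hpow : ∀ k, 1 ≤ k → k ≤ J → (64 : ℝ) ≤ 64 ^ k ∧ (64 : ℝ) ^ k ≤ T := fun k h1 h2 =>
      ⟨by simpa using pow_le_pow_right₀ (by norm_num : (1 : ℝ) ≤ 64) h1,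
        pow_le_pow_right₀ (by norm_num) h2⟩
    have e1 : p < 8 * 64 ^ i * q := by
      calc p ≤ 64 ^ i * (64 ^ j * N) := by rw [← mul_assoc, ← pow_add]; exact hp
        _ < 64 ^ i * (8 * q) := by gcongr
        _ = _ := by ring
    have e2 : p < 8 * 64 ^ j * r := by
      calc p ≤ 64 ^ j * (64 ^ i * N) := by rw [← mul_assoc, ← pow_add, add_comm j]; exact hp
        _ < 64 ^ j * (8 * r) := by gcongr
        _ = _ := by ring
    have e3 : 64 ^ i * q < 8 * p := by
      calc 64 ^ i * q ≤ 64 ^ i * (64 ^ j * N) := by gcongr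
        _ < 8 * p := by rw [← mul_assoc, ← pow_add]; exact hp'
    have e4 : 64 ^ j * r < 8 * p := by
      calc 64 ^ j * r ≤ 64 ^ j * (64 ^ i * N) := by gcongr
        _ < 8 * p := by rw [← mul_assoc, ← pow_add, add_comm j]; exact hp'
    have e1' : (p : ℝ) ≤ 8 * 64 ^ i * q := by exact_mod_cast e1.le
    have e2' : (p : ℝ) ≤ 8 * 64 ^ j * r := by exact_mod_cast e2.le
    have e3' : 64 ^ i * (q : ℝ) ≤ 8 * p := by exact_mod_cast e3.le
    have e4' : 64 ^ j * (r : ℝ) ≤ 8 * p := by exact_mod_cast e4.le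
    have hq1 : (0 : ℝ) ≤ q := Nat.cast_nonneg q
    have hr1 : (0 : ℝ) ≤ r := Nat.cast_nonneg r
    refine ⟨hq0, hr0, ?_, ?_, ?_, ?_, ?_, hgcd, e1, e3, e2, e4⟩
    · have := mul_le_mul_of_nonneg_right (hpow i hi hiJ).1 hq1
      linarith
    · have := mul_le_mul_of_nonneg_right (hpow j hj hjJ).1 hr1
      linarith
    · have := mul_le_mul_of_nonneg_right (hpow i hi hiJ).2 hq1
      linarith
    · have := mul_le_mul_of_nonneg_right (hpow j hj hjJ).2 hr1
      linarith
    · have h1 : p * q * r ≤ 64 ^ (i + j) * N * (64 ^ j * N) * (64 ^ i * N) := by gcongr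
      have h2 : (p : ℝ) * q * r ≤ 64 ^ (i + j) * N * (64 ^ j * N) * (64 ^ i * N) := by
        exact_mod_cast h1
      refine h2.trans (le_trans (le_of_eq ?_) hX')
      ring
  norm_cast
  refine M.card_le_ncard_primitiveIdeals _ (fun z => z.2.1) (fun z => z.2.2.1)
    (fun z => z.2.2.2) (fun z => z.2.1) (κ := 64 * T ^ 2) (l₁ := a / (8 * T)) (l₂ := 1 / 2)
    (l₃ := a / (8 * T)) (u₁ := a) (u₂ := 1) (u₃ := a) (by positivity) (by norm_num)
    (by positivity) (by positivity) ?_ ?_ ?_ (by nlinarith) ?_ ?_ ?_ ?_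
  · rw [show 64 * T ^ 2 * (a / (8 * T) * (1 / 2)) = 4 * T * (a : ℝ) by field_simp; ring]
    nlinarith
  · rw [show 64 * T ^ 2 * (a / (8 * T) * (a / (8 * T))) = (a : ℝ) * a by field_simp; ring]
  · rw [show 64 * T ^ 2 * (1 / 2 * (a / (8 * T))) = 4 * T * (a : ℝ) by field_simp; ring]
    nlinarith
  · intro z hz
    obtain ⟨h1, h2, h3, h4, h5, h6, -⟩ := hmem z hz
    exact M.balanced_of_ratio (by linarith) h1 h2 h3 h4 h5 h6
  · intro z hz
    obtain ⟨h1, h2, h3, h4, h5, h6, h7, -⟩ := hmem z hz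
    refine (M.norm_le_of_ratio (by linarith) h1 h2 h3 h4 h5 h6 hT8).trans (le_trans ?_ hx)
    gcongr
  · intro z hz n h1 h2 h3
    exact dvd_one_of_gcd_eq_one (hmem z hz).2.2.2.2.2.2.2.1 h1 h2 h3
  · rintro ⟨⟨i, j⟩, p, q, r⟩ hz ⟨⟨i', j'⟩, p', q', r'⟩ hz' h1 h2 h3
    obtain ⟨-, -, -, -, -, -, -, -, e1, e2, e3, e4⟩ := hmem _ hz
    obtain ⟨-, -, -, -, -, -, -, -, e1', e2', e3', e4'⟩ := hmem _ hz'
    dsimp only at *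
    obtain rfl : p = p' := by exact_mod_cast h1
    obtain rfl : q = q' := by exact_mod_cast h2
    obtain rfl : r = r' := by exact_mod_cast h3
    obtain rfl : i = i' := le_antisymm (pow_le_of_ratio e1' e2) (pow_le_of_ratio e1 e2')
    obtain rfl : j = j' := le_antisymm (pow_le_of_ratio e3' e4) (pow_le_of_ratio e3 e4')
    rfl

end SimplestCubicModel

namespace SimplestCubicModel

variable {a : ℤ} {K : Type} [Field K] [NumberField K]

lemma rpow_le_ncard_primitiveIdeals (M : SimplestCubicModel a K) {x : ℝ} (hx : 1 ≤ x) :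
    (x / a) ^ ((2 : ℝ) / 3) ≤ 400 * (primitiveIdeals K x).ncard := by
  have ha := M.roots.eight_le
  have hP : (1 : ℝ) ≤ (primitiveIdeals K x).ncard := by
    exact_mod_cast M.one_le_ncard_primitiveIdeals hx
  have key : ∀ N : ℕ, x / a ≤ (10 * (N : ℝ)) ^ 3 → (x / a) ^ ((2 : ℝ) / 3) ≤ 100 * (N : ℝ) ^ 2 := by
    intro N hN
    calc (x / a) ^ ((2 : ℝ) / 3) ≤ ((10 * (N : ℝ)) ^ 3) ^ ((2 : ℝ) / 3) := by gcongr
      _ = (10 * (N : ℝ)) ^ 2 := by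
        rw [← Real.rpow_natCast _ 3, ← Real.rpow_mul (by positivity), ← Real.rpow_natCast]
        norm_num
      _ = _ := by ring
  rcases lt_or_ge (x / (104 * a)) 1 with h | h
  · rw [div_lt_one (by positivity)] at h
    have := key 1 (by rw [div_le_iff₀ (by positivity)]; norm_num; linarith)
    norm_num at this
    linarith
  · obtain ⟨N, -, h2, h3⟩ := exists_nat_cube h
    rw [le_div_iff₀ (by positivity)] at h2
    rw [div_le_iff₀ (by positivity)] at h3
    have h4 := M.sq_le_ncard_primitiveIdeals (x := x) (N := N) (by linarith)
    have h5 := key N (by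
      rw [div_le_iff₀ (by positivity), mul_pow]
      nlinarith [show 0 ≤ (a : ℝ) * (N : ℝ) ^ 3 by positivity])
    linarith

lemma log_sq_mul_le_rpow {a x : ℝ} (ha : 8 ≤ a) (hx : 0 ≤ x) (hxa : x ≤ (210 * a) ^ 3) :
    Real.log a ^ 2 * x / a ^ 2 ≤ 7560 * (x / a) ^ ((2 : ℝ) / 3) := by
  have ha0 : 0 ≤ a := by linarith
  have hv0 : 0 ≤ x / a := by positivity
  have hlog := Real.log_le_rpow_div ha0 (show (0 : ℝ) < 1 / 6 by norm_num)
  have hlog0 : 0 ≤ Real.log a := Real.log_nonneg (by linarith)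
  set b := a ^ ((1 : ℝ) / 3) with hb
  have hb0 : 0 < b := by positivity
  have hb3 : b ^ 3 = a := by
    rw [hb, ← Real.rpow_natCast, ← Real.rpow_mul ha0]; norm_num
  have hlog2 : Real.log a ^ 2 ≤ 36 * b := by
    calc Real.log a ^ 2 ≤ (a ^ ((1 : ℝ) / 6) / (1 / 6)) ^ 2 := by gcongr
      _ = 36 * (a ^ ((1 : ℝ) / 6)) ^ 2 := by ring
      _ = 36 * b := by
        rw [hb, ← Real.rpow_natCast, ← Real.rpow_mul ha0]; norm_num
  set w := (x / a) ^ ((1 : ℝ) / 3) with hw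
  have hw0 : 0 ≤ w := by positivity
  have hw3 : w ^ 3 = x / a := by
    rw [hw, ← Real.rpow_natCast, ← Real.rpow_mul hv0]; norm_num
  have hw2 : (x / a) ^ ((2 : ℝ) / 3) = w ^ 2 := by
    rw [hw, ← Real.rpow_natCast, ← Real.rpow_mul hv0]; norm_num
  have hwb : w ≤ 210 * b ^ 2 := by
    refine le_of_pow_le_pow_left₀ three_ne_zero (by positivity) ?_
    rw [hw3, div_le_iff₀ (by linarith)]
    calc x ≤ (210 * a) ^ 3 := hxa
      _ = (210 * b ^ 2) ^ 3 * a := by rw [← hb3]; ring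
  rw [hw2, show Real.log a ^ 2 * x / a ^ 2 = Real.log a ^ 2 * (x / a) / a by field_simp, ← hw3,
    div_le_iff₀ (by linarith)]
  calc Real.log a ^ 2 * w ^ 3 ≤ 36 * b * (w ^ 2 * (210 * b ^ 2)) := by
        rw [pow_succ w 2]; gcongr
    _ = 7560 * w ^ 2 * b ^ 3 := by ring
    _ = _ := by rw [hb3]

lemma log_le_ncard_primitiveIdeals (M : SimplestCubicModel a K) {x : ℝ} (hx : 1 ≤ x) :
    Real.log a ^ 2 * x / (a : ℝ) ^ 2 ≤ 10 ^ 19 * (primitiveIdeals K x).ncard := by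
  have ha := M.roots.eight_le
  have hP : (1 : ℝ) ≤ (primitiveIdeals K x).ncard := by
    exact_mod_cast M.one_le_ncard_primitiveIdeals hx
  have hlog0 : 0 ≤ Real.log a := Real.log_nonneg (by linarith)
  have hlogpow : ∀ k : ℕ, (a : ℝ) ≤ 2 ^ k → Real.log a ≤ k := by
    intro k hk
    calc Real.log a ≤ Real.log (2 ^ k) := Real.log_le_log (by linarith) hk
      _ = k * Real.log 2 := Real.log_pow _ _
      _ ≤ k * 1 := by
        gcongr
        linarith [Real.log_two_lt_d9]
      _ = k := mul_one _
  rcases le_total x ((210 * a) ^ 3) with h | h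
  · have h1 := log_sq_mul_le_rpow ha (by linarith) h
    have h2 := M.rpow_le_ncard_primitiveIdeals hx
    linarith
  rcases lt_or_ge (a : ℝ) (2 ^ 24) with h24 | h24
  · obtain ⟨N, -, h2, h3⟩ := exists_nat_cube ((one_le_div (by positivity)).2 h)
    rw [le_div_iff₀ (by positivity)] at h2
    rw [div_le_iff₀ (by positivity)] at h3
    have h4 := M.cube_le_ncard_primitiveIdeals (x := x) (N := N) (by rw [mul_pow]; linarith)
    have h5 := hlogpow 24 h24.le
    rw [div_le_iff₀ (by positivity)]
    calc Real.log a ^ 2 * x ≤ (24 : ℕ) ^ 2 * (8 * (N : ℝ) ^ 3 * (210 * a) ^ 3) := by gcongr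
      _ = 576 * 8 * 210 ^ 3 * (N : ℝ) ^ 3 * a * (a : ℝ) ^ 2 := by push_cast; ring
      _ ≤ 576 * 8 * 210 ^ 3 * (8 / 3 * (primitiveIdeals K x).ncard) * 2 ^ 24 * (a : ℝ) ^ 2 := by
        gcongr
        linarith
      _ ≤ _ := by
        refine mul_le_mul_of_nonneg_right ?_ (by positivity)
        linarith
  · set J := Nat.log (2 ^ 24) a.toNat with hJ
    have hcast : ((a.toNat : ℕ) : ℝ) = a := by
      have : ((a.toNat : ℕ) : ℤ) = a := Int.toNat_of_nonneg (by
        have : (0 : ℝ) ≤ a := by linarith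
        exact_mod_cast this)
      exact_mod_cast congrArg (Int.cast : ℤ → ℝ) this
    have h24' : 2 ^ 24 ≤ a.toNat := by rw [← hcast] at h24; exact_mod_cast h24
    have hJ1 : 1 ≤ J := Nat.log_pos (by norm_num) h24'
    have hJa : (64 : ℝ) ^ (4 * J) ≤ a := by
      have h1 : (2 ^ 24) ^ J ≤ a.toNat := Nat.pow_log_le_self _ (by omega)
      calc (64 : ℝ) ^ (4 * J) = (2 ^ 24) ^ J := by rw [pow_mul]; norm_num
        _ ≤ a.toNat := by exact_mod_cast h1
        _ = a := hcast
    have hlog : Real.log a ≤ 48 * J := by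
      have h1 : a.toNat < (2 ^ 24) ^ (J + 1) := Nat.lt_pow_succ_log_self (by norm_num) _
      have h2 : (a : ℝ) ≤ 2 ^ (24 * (J + 1)) := by
        rw [← hcast, pow_mul]; exact_mod_cast h1.le
      have h3 := hlogpow _ h2
      push_cast at h3
      have h4 : (1 : ℝ) ≤ J := by exact_mod_cast hJ1
      linarith
    have hX : (a : ℝ) ≤ x / (9 * (a : ℝ) ^ 2) := by
      rw [le_div_iff₀ (by positivity)]
      have : 0 ≤ (a : ℝ) ^ 3 := by positivity
      linarith
    have h4 := M.log_sq_le_ncard_primitiveIdeals hJ1 hJa hX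
      (x := x) (le_of_eq (mul_div_cancel₀ _ (by positivity)))
    rw [mul_div_assoc]
    calc Real.log a ^ 2 * (x / (a : ℝ) ^ 2) ≤ (48 * J) ^ 2 * (x / (a : ℝ) ^ 2) := by gcongr
      _ = 442368 * ((J : ℝ) ^ 2 * (3 / 64 * (x / (9 * (a : ℝ) ^ 2)))) := by
        field_simp
        ring
      _ ≤ 442368 * (primitiveIdeals K x).ncard := by gcongr
      _ ≤ _ := by gcongr; norm_num

lemma le_ncard_primitiveIdeals (M : SimplestCubicModel a K) {x : ℝ} (hx : 1 ≤ x) :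
    1 / 10 ^ 20 * (Real.log a ^ 2 * x / (a : ℝ) ^ 2 + (x / a) ^ ((2 : ℝ) / 3) + 1) ≤
      (primitiveIdeals K x).ncard := by
  have h1 := M.rpow_le_ncard_primitiveIdeals hx
  have h2 := M.log_le_ncard_primitiveIdeals hx
  have hP : (1 : ℝ) ≤ (primitiveIdeals K x).ncard := by
    exact_mod_cast M.one_le_ncard_primitiveIdeals hx
  linarith

end SimplestCubicModel

lemma simplestCubicRoot_spec {a : ℤ} (ha : 8 ≤ a) :
    simplestCubicRoot a ^ 3 - (a : ℝ) * simplestCubicRoot a ^ 2 -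
      ((a : ℝ) + 3) * simplestCubicRoot a - 1 = 0 ∧
    (a : ℝ) + 1 < simplestCubicRoot a ∧ simplestCubicRoot a < a + 2 := by
  have ha' : (8 : ℝ) ≤ a := by exact_mod_cast ha
  set f : ℝ → ℝ := fun x => x ^ 3 - (a : ℝ) * x ^ 2 - ((a : ℝ) + 3) * x - 1 with hf
  have hcont : Continuous f := by fun_prop
  have hlt : ∀ x, f x = 0 → x < a + 2 := by
    intro x hx
    by_contra hle
    push Not at hle
    have h1 : f x = x ^ 2 * (x - (a + 2)) + x * (x - (a + 2)) + x * (x - 1) - 1 := by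
      simp only [hf]; ring
    have h2 : 0 ≤ x ^ 2 * (x - (a + 2)) := mul_nonneg (sq_nonneg x) (by linarith)
    nlinarith
  obtain ⟨y, hy, hy0⟩ : ∃ y ∈ Set.Ioo ((a : ℝ) + 1) (a + 2), f y = 0 := by
    refine intermediate_value_Ioo (by linarith) hcont.continuousOn ⟨?_, ?_⟩
    · simp only [hf]; nlinarith
    · simp only [hf]; nlinarith
  have hbdd : BddAbove {x | f x = 0} := ⟨a + 2, fun x hx => (hlt x hx).le⟩
  have hmem : simplestCubicRoot a ∈ {x | f x = 0} :=
    (isClosed_eq hcont continuous_const).csSup_mem ⟨y, hy0⟩ hbdd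
  exact ⟨hmem, hy.1.trans_le (le_csSup hbdd hy0), hlt _ hmem⟩

lemma cubicRoots_of_eval_eq_zero {a B : ℝ} (ha : 8 ≤ a) (h1 : a + 1 < B) (h2 : B < a + 2)
    (hB : B ^ 3 - a * B ^ 2 - (a + 3) * B - 1 = 0) :
    CubicRoots a B (-1 - 1 / B) (-1 / (1 + B)) := by
  have hB0 : B ≠ 0 := by linarith
  have hB1 : 1 + B ≠ 0 := by linarith
  refine ⟨ha, h1, h2, ?_, ?_, ?_, ?_⟩
  · field_simp
    linear_combination hB
  · field_simp
    ring
  · field_simp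
    ring
  · field_simp
    ring

namespace CubicRoots

variable {a B m e : ℝ} (h : CubicRoots a B m e)
include h

lemma eval_mid : m ^ 3 - a * m ^ 2 - (a + 3) * m - 1 = 0 := by
  linear_combination m ^ 2 * h.sum_eq - m * h.pair_sum_eq + h.prod_eq

lemma eval_small : e ^ 3 - a * e ^ 2 - (a + 3) * e - 1 = 0 := by
  linear_combination e ^ 2 * h.sum_eq - e * h.pair_sum_eq + h.prod_eq

end CubicRoots

section minimalPolynomial

open Polynomial

/-- The polynomial `X³ - aX² - (a+3)X - 1` over the rationals. -/
noncomputable def simplestCubicPoly (a : ℤ) : ℚ[X] :=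
  X ^ 3 - C (a : ℚ) * X ^ 2 - C ((a : ℚ) + 3) * X - 1

lemma natDegree_simplestCubicPoly (a : ℤ) : (simplestCubicPoly a).natDegree = 3 := by
  unfold simplestCubicPoly
  compute_degree!

lemma monic_simplestCubicPoly (a : ℤ) : (simplestCubicPoly a).Monic := by
  unfold simplestCubicPoly
  monicity!

lemma aeval_simplestCubicPoly {A : Type*} [CommRing A] [Algebra ℚ A] (a : ℤ) (y : A) :
    aeval y (simplestCubicPoly a) = y ^ 3 - a * y ^ 2 - (a + 3) * y - 1 := by
  simp [simplestCubicPoly, map_ofNat (algebraMap ℚ A) 3]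

lemma irreducible_simplestCubicPoly (a : ℤ) : Irreducible (simplestCubicPoly a) := by
  have hmonic := monic_simplestCubicPoly a
  have hdeg := natDegree_simplestCubicPoly a
  rw [hmonic.irreducible_iff_roots_eq_zero_of_degree_le_three (by omega) (by omega),
    Multiset.eq_zero_iff_forall_notMem]
  intro y hy
  have hy0 : y ^ 3 - a * y ^ 2 - (a + 3) * y - 1 = 0 := by
    rw [← aeval_simplestCubicPoly, coe_aeval_eq_eval]
    exact (mem_roots'.1 hy).2
  refine indexForm_ne_zero a y.num (-y.den) (fun h => y.den_ne_zero (by omega)) ?_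
  have hd : (y.den : ℚ) ≠ 0 := by exact_mod_cast y.den_ne_zero
  have hnum : (y.num : ℚ) = y * y.den := by rw [Rat.mul_den_eq_num]
  have : ((y.num ^ 3 + a * y.num ^ 2 * (-y.den) - (a + 3) * y.num * (-y.den) ^ 2 + (-y.den) ^ 3 : ℤ)
      : ℚ) = 0 := by
    push_cast
    rw [hnum]
    linear_combination (y.den : ℚ) ^ 3 * hy0
  exact_mod_cast this

end minimalPolynomial

lemma CubicRoots.mid_eq {a B m e : ℝ} (h : CubicRoots a B m e) :
    m = a + 2 + a * B - B ^ 2 := by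
  linear_combination B * h.sum_eq - h.small_mul_big - h.big_mul_mid + h.sum_eq

lemma CubicRoots.small_eq {a B m e : ℝ} (h : CubicRoots a B m e) :
    e = a + 2 + a * m - m ^ 2 := by
  linear_combination m * h.sum_eq - h.mid_mul_small - h.big_mul_mid + h.sum_eq

lemma CubicRoots.big_eq {a B m e : ℝ} (h : CubicRoots a B m e) :
    B = a + 2 + a * e - e ^ 2 := by
  linear_combination e * h.sum_eq - h.mid_mul_small - h.small_mul_big + h.sum_eq

/-- In a cubic number field with three distinct real embeddings, the absolute norm of a principal
ideal is the absolute value of the product of the three conjugates of a generator. -/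
lemma absNorm_span_singleton_eq_abs_mul {K : Type*} [Field K] [NumberField K]
    (hdim : Module.finrank ℚ K = 3) {φ₁ φ₂ φ₃ : K →ₐ[ℚ] ℝ} (h₁₂ : φ₁ ≠ φ₂) (h₁₃ : φ₁ ≠ φ₃)
    (h₂₃ : φ₂ ≠ φ₃) (z : 𝓞 K) :
    (Ideal.absNorm (Ideal.span {z}) : ℝ) = |φ₁ z * φ₂ z * φ₃ z| := by
  classical
  let ι : ℝ →ₐ[ℚ] ℂ := IsScalarTower.toAlgHom ℚ ℝ ℂ
  have hι : Function.Injective fun φ : K →ₐ[ℚ] ℝ => ι.comp φ := by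
    intro φ ψ h
    ext y
    exact ι.toRingHom.injective (DFunLike.congr_fun h y)
  have huniv : ({ι.comp φ₁, ι.comp φ₂, ι.comp φ₃} : Finset (K →ₐ[ℚ] ℂ)) = Finset.univ := by
    rw [← Finset.card_eq_iff_eq_univ, AlgHom.card, hdim]
    exact Finset.card_eq_three.2 ⟨_, _, _, hι.ne h₁₂, hι.ne h₁₃, hι.ne h₂₃, rfl⟩
  have hprod : ((Algebra.norm ℚ (z : K) : ℚ) : ℝ) = φ₁ z * φ₂ z * φ₃ z := by
    have h := Algebra.norm_eq_prod_embeddings ℚ ℂ (z : K)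
    rw [← huniv, Finset.prod_insert (by simpa using ⟨hι.ne h₁₂, hι.ne h₁₃⟩),
      Finset.prod_insert (by simpa using hι.ne h₂₃), Finset.prod_singleton] at h
    have h' : (((Algebra.norm ℚ (z : K) : ℚ) : ℝ) : ℂ) =
        ((φ₁ z * (φ₂ z * φ₃ z) : ℝ) : ℂ) := by
      push_cast
      exact h
    rw [mul_assoc]
    exact_mod_cast h'
  rw [← hprod, Ideal.absNorm_span_singleton, ← Algebra.coe_norm_int, Nat.cast_natAbs]
  push_cast
  rfl

lemma exists_eq_of_mem_adjoin_of_cubic {K : Type*} [CommRing K] {a : ℤ} {t z : K}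
    (ht : t ^ 3 - a * t ^ 2 - (a + 3) * t - 1 = 0) (hz : z ∈ Algebra.adjoin ℤ {t}) :
    ∃ u v w : ℤ, z = u + v * t + w * t ^ 2 := by
  induction hz using Algebra.adjoin_induction with
  | mem y hy =>
    obtain rfl := hy
    exact ⟨0, 1, 0, by push_cast; ring⟩
  | algebraMap n => exact ⟨n, 0, 0, by simp⟩
  | add y₁ y₂ _ _ h₁ h₂ =>
    obtain ⟨u, v, w, rfl⟩ := h₁
    obtain ⟨u', v', w', rfl⟩ := h₂
    exact ⟨u + u', v + v', w + w', by push_cast; ring⟩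
  | mul y₁ y₂ _ _ h₁ h₂ =>
    obtain ⟨u, v, w, rfl⟩ := h₁
    obtain ⟨u', v', w', rfl⟩ := h₂
    refine ⟨u * u' + (v * w' + w * v') + w * w' * a,
      u * v' + v * u' + (v * w' + w * v') * (a + 3) + w * w' * (a * (a + 3) + 1),
      u * w' + v * v' + w * u' + (v * w' + w * v') * a + w * w' * (a ^ 2 + (a + 3)), ?_⟩
    push_cast
    linear_combination ((v : K) * w' + w * v' + w * w' * (t + a)) * ht

lemma nonempty_simplestCubicModel {a : ℤ} (ha : 8 ≤ a) {K : Type} [Field K] [NumberField K]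
    {σ : K →+* ℝ} {t : K} (hσ : σ t = simplestCubicRoot a)
    (htop : IntermediateField.adjoin ℚ {t} = ⊤)
    (hint : Algebra.adjoin ℤ {t} = integralClosure ℤ K) :
    Nonempty (SimplestCubicModel a K) := by
  obtain ⟨hB, hB₁, hB₂⟩ := simplestCubicRoot_spec ha
  have hR := cubicRoots_of_eval_eq_zero (by exact_mod_cast ha) hB₁ hB₂ hB
  generalize simplestCubicRoot a = B at *
  obtain ⟨m, hm⟩ : ∃ m, m = -1 - 1 / B := ⟨_, rfl⟩
  obtain ⟨e, he⟩ : ∃ e, e = -1 / (1 + B) := ⟨_, rfl⟩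
  rw [← hm, ← he] at hR
  have ht : t ^ 3 - a * t ^ 2 - (a + 3) * t - 1 = 0 := by
    apply σ.injective
    simp only [map_sub, map_add, map_mul, map_pow, map_intCast, map_ofNat, map_one, map_zero, hσ]
    exact hB
  have hmin : minpoly ℚ t = simplestCubicPoly a :=
    (minpoly.eq_of_irreducible_of_monic (irreducible_simplestCubicPoly a)
      (by rw [aeval_simplestCubicPoly, ht]) (monic_simplestCubicPoly a)).symm
  have htop' : Algebra.adjoin ℚ {t} = ⊤ := by
    rw [← IntermediateField.adjoin_simple_toSubalgebra_of_isAlgebraic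
      (IsAlgebraic.of_finite ℚ t), htop, IntermediateField.top_toSubalgebra]
  let pb := PowerBasis.ofAdjoinEqTop' (IsIntegral.of_finite ℚ t) htop'
  have hgen : pb.gen = t := PowerBasis.ofAdjoinEqTop'_gen _ _
  have hdim : Module.finrank ℚ K = 3 := by
    rw [pb.finrank, PowerBasis.ofAdjoinEqTop'_dim, hmin, natDegree_simplestCubicPoly]
  have hlift : ∀ y : ℝ, y ^ 3 - a * y ^ 2 - (a + 3) * y - 1 = 0 →
      ∃ φ : K →ₐ[ℚ] ℝ, φ t = y := by
    intro y hy
    have hy' : Polynomial.aeval y (minpoly ℚ pb.gen) = 0 := by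
      rw [hgen, hmin, aeval_simplestCubicPoly, hy]
    refine ⟨pb.lift y hy', ?_⟩
    conv_lhs => rw [← hgen]
    exact pb.lift_gen y hy'
  obtain ⟨φ₁, h₁⟩ := hlift B hB
  obtain ⟨φ₂, h₂⟩ := hlift m hR.eval_mid
  obtain ⟨φ₃, h₃⟩ := hlift e hR.eval_small
  have hB0 : 8 < B := by linarith [hR.eight_le]
  have hm1 : m < -1 := by
    have : 0 < 1 / B := by positivity
    linarith
  have he0 : -1 < e ∧ e < 0 := by
    rw [he]
    constructor
    · rw [lt_div_iff₀ (by linarith)]; linarith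
    · exact div_neg_of_neg_of_pos (by norm_num) (by linarith)
  have h₁₂ : φ₁ ≠ φ₂ := by rintro rfl; linarith
  have h₁₃ : φ₁ ≠ φ₃ := by rintro rfl; linarith
  have h₂₃ : φ₂ ≠ φ₃ := by rintro rfl; linarith
  have htint : IsIntegral ℤ t := by
    have : t ∈ integralClosure ℤ K := hint ▸ Algebra.self_mem_adjoin_singleton ℤ t
    exact this
  let θ : 𝓞 K := ⟨t, htint⟩
  have hθ : (θ : K) = t := rfl
  let θ' : 𝓞 K := a + 2 + a * θ - θ ^ 2
  have hθ' : (θ' : K) = a + 2 + a * t - t ^ 2 := by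
    simp only [θ', map_sub, map_add, map_mul, map_pow, map_intCast, map_ofNat, hθ]
  let s (φ : K →ₐ[ℚ] ℝ) : 𝓞 K →+* ℝ := (φ : K →+* ℝ).comp (algebraMap (𝓞 K) K)
  have hs : ∀ (φ : K →ₐ[ℚ] ℝ) (z : 𝓞 K), s φ z = φ z := fun _ _ => rfl
  have hsθ' : ∀ φ : K →ₐ[ℚ] ℝ, s φ θ' = a + 2 + a * φ t - φ t ^ 2 := by
    intro φ
    rw [hs, hθ']
    simp only [map_sub, map_add, map_mul, map_pow, map_intCast, map_ofNat]
  refine ⟨⟨B, m, e, hR, θ, θ', s φ₁, s φ₂, s φ₃, h₁, h₂, h₃, ?_, ?_, ?_, ?_,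
    absNorm_span_singleton_eq_abs_mul hdim h₁₂ h₁₃ h₂₃⟩⟩
  · rw [hsθ', h₁, ← hR.mid_eq]
  · rw [hsθ', h₂, ← hR.small_eq]
  · rw [hsθ', h₃, ← hR.big_eq]
  · intro z
    have hz : (z : K) ∈ Algebra.adjoin ℤ {t} := hint ▸ z.isIntegral_coe
    obtain ⟨u, v, w, hz⟩ := exists_eq_of_mem_adjoin_of_cubic ht hz
    refine ⟨u + w * (a + 2), v + w * a, -w, RingOfIntegers.ext ?_⟩
    simp only [map_add, map_mul, map_intCast, hθ, hθ', hz]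
    push_cast
    ring

theorem stmt_1 :
    ∃ c₁ c₂ : ℝ, 0 < c₁ ∧ 0 < c₂ ∧
      ∀ (a : ℤ), 8 ≤ a →
      ∀ (K : Type) [Field K] [NumberField K] (σ : K →+* ℝ) (ρK : K),
        σ ρK = simplestCubicRoot a →
        IntermediateField.adjoin ℚ {ρK} = ⊤ →
        Algebra.adjoin ℤ {ρK} = integralClosure ℤ K →
        ∀ x : ℝ, 1 ≤ x →
          c₁ * ((Real.log a) ^ 2 * x / (a : ℝ) ^ 2 + (x / a) ^ ((2 : ℝ) / 3) + 1) ≤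
            (Set.ncard {I : Ideal (RingOfIntegers K) |
                I ≠ ⊥ ∧ Submodule.IsPrincipal I ∧ (Ideal.absNorm I : ℝ) ≤ x ∧
                ∀ n : ℤ, 2 ≤ n → ¬ I ≤ Ideal.span {(n : RingOfIntegers K)}} : ℝ) ∧
          (Set.ncard {I : Ideal (RingOfIntegers K) |
                I ≠ ⊥ ∧ Submodule.IsPrincipal I ∧ (Ideal.absNorm I : ℝ) ≤ x ∧
                ∀ n : ℤ, 2 ≤ n → ¬ I ≤ Ideal.span {(n : RingOfIntegers K)}} : ℝ) ≤
            c₂ * ((Real.log a) ^ 2 * x / (a : ℝ) ^ 2 + (x / a) ^ ((2 : ℝ) / 3) + 1) := by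
  refine ⟨1 / 10 ^ 20, 10 ^ 9, by norm_num, by norm_num, ?_⟩
  intro a ha K _ _ σ ρK hσ htop hint x hx
  obtain ⟨M⟩ := nonempty_simplestCubicModel ha hσ htop hint
  exact ⟨M.le_ncard_primitiveIdeals hx, M.ncard_primitiveIdeals_le (by linarith)⟩
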